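/- arXiv:1911.00178 — 2 statements merged into one kernel-verified Lean document; each statement's English description precedes it below -/
import Mathlib

section
/- There exist an absolute constant c > 0 and n₀ ∈ ℕ such that for all n ≥ n₀ and every centrally symmetric convex set K ⊆ ℝⁿ, at least one of the following three hypothesis functions h : ℝⁿ → {−1, 1} satisfies Pr_{x ∼ N(0,1)ⁿ}[h(x) = K(x)] ≥ 1/2 + c/√n: (i) h ≡ −1 (the empty set), (ii) h ≡ 1 (all of ℝⁿ), (iii) h(x) = 1 if ‖x‖₂ ≤ r_median and h(x) = −1 otherwise (the origin-centered ball of radius r_median). -/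
open MeasureTheory ProbabilityTheory

/-- The standard Gaussian measure `N(0,1)ⁿ` on `ℝⁿ`. -/
noncomputable def stdGaussian (n : ℕ) : Measure (EuclideanSpace ℝ (Fin n)) :=
  (Measure.pi fun _ : Fin n => gaussianReal 0 1).map
    (EuclideanSpace.equiv (Fin n) ℝ).symm

open Classical in
/-- The `±1`-valued function associated to a set `K`. -/
noncomputable def pmInd {n : ℕ} (K : Set (EuclideanSpace ℝ (Fin n)))
    (x : EuclideanSpace ℝ (Fin n)) : ℝ :=
  if x ∈ K then 1 else -1

namespace GaussianConvex

open Real Set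

section Density

variable (E : Type*) [NormedAddCommGroup E] [InnerProductSpace ℝ E] [FiniteDimensional ℝ E]
  [MeasurableSpace E] [BorelSpace E]

lemma stdGaussian_eq_withDensity :
    ProbabilityTheory.stdGaussian E = volume.withDensity fun x : E ↦
      ENNReal.ofReal ((2 * π) ^ (-(Module.finrank ℝ E / 2 : ℝ)) * exp (-(1 / 2) * ‖x‖ ^ 2)) := by
  set c : ℝ := (2 * π) ^ (-(Module.finrank ℝ E / 2 : ℝ)) with hc
  have hc0 : 0 < c := by positivity
  have hint : Integrable (fun x : E ↦ c * exp (-(1 / 2) * ‖x‖ ^ 2)) := by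
    have := GaussianFourier.integrable_cexp_neg_mul_sq_norm_add (V := E) (b := 1 / 2)
      (by norm_num) 0 0
    refine (this.norm.congr (.of_forall fun x ↦ ?_)).const_mul c
    simp [Complex.norm_exp, ← Complex.ofReal_pow]
  have : IsFiniteMeasure (volume.withDensity fun x : E ↦
      ENNReal.ofReal (c * exp (-(1 / 2) * ‖x‖ ^ 2))) :=
    isFiniteMeasure_withDensity_ofReal hint.2
  refine Measure.ext_of_charFun ?_
  ext t
  rw [charFun_stdGaussian, charFun_apply, integral_withDensity_eq_integral_toReal_smul
    (by fun_prop) (by simp)]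
  have key := GaussianFourier.integral_cexp_neg_mul_sq_norm_add (V := E) (b := 1 / 2)
    (by norm_num) Complex.I t
  have h2 : ∀ x : E, (ENNReal.ofReal (c * exp (-(1 / 2) * ‖x‖ ^ 2))).toReal •
      Complex.exp (inner ℝ x t * Complex.I) =
      c * Complex.exp (-(1 / 2) * ‖x‖ ^ 2 + Complex.I * inner ℝ t x) := by
    intro x
    rw [ENNReal.toReal_ofReal (by positivity), Complex.real_smul, Complex.exp_add,
      real_inner_comm]
    push_cast
    rw [mul_assoc, mul_comm Complex.I]
  simp_rw [h2]
  rw [integral_const_mul, key, ← mul_assoc]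
  have h3 : (c : ℂ) * (π / (1 / 2)) ^ (Module.finrank ℝ E / 2 : ℂ) = 1 := by
    have : (π / (1 / 2) : ℂ) = ((2 * π : ℝ) : ℂ) := by push_cast; ring
    rw [this, show (Module.finrank ℝ E / 2 : ℂ) = ((Module.finrank ℝ E / 2 : ℝ) : ℂ) by
      push_cast; ring, ← Complex.ofReal_cpow (by positivity), ← Complex.ofReal_mul, hc,
      ← rpow_add (by positivity)]
    simp
  rw [h3, one_mul, Complex.I_sq]
  congr 1
  ring

lemma stdGaussian_absolutelyContinuous :
    ProbabilityTheory.stdGaussian E ≪ volume := by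
  rw [stdGaussian_eq_withDensity]
  exact withDensity_absolutelyContinuous _ _

lemma exists_lintegral_polar [Nontrivial E] :
    ∃ g : ℝ → ENNReal, Measurable g ∧ ∀ f : E → ENNReal, Measurable f →
      ∫⁻ x, f x ∂ProbabilityTheory.stdGaussian E =
        ∫⁻ u, ∫⁻ r, f (r.1 • u.1) * g r.1
          ∂Measure.volumeIoiPow (Module.finrank ℝ E - 1) ∂(volume : Measure E).toSphere := by
  set g : ℝ → ENNReal := fun r ↦
    ENNReal.ofReal ((2 * π) ^ (-(Module.finrank ℝ E / 2 : ℝ)) * exp (-(1 / 2) * r ^ 2))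
  have hg : Measurable g := by fun_prop
  refine ⟨g, hg, fun f hf ↦ ?_⟩
  rw [stdGaussian_eq_withDensity]
  rw [lintegral_withDensity_eq_lintegral_mul _ (by fun_prop) hf]
  have hmp := (volume : Measure E).measurePreserving_homeomorphUnitSphereProd
  rw [← lintegral_prod (fun z : Metric.sphere (0 : E) 1 × Ioi (0 : ℝ) ↦
    f (z.2.1 • z.1.1) * g z.2.1) (by fun_prop)]
  rw [← hmp.lintegral_comp_emb (Homeomorph.measurableEmbedding _)]
  have h4 := (MeasurableEmbedding.subtype_coe
    (measurableSet_singleton (0 : E)).compl).lintegral_map (μ := (volume : Measure E).comap Subtype.val)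
      (fun x ↦ g ‖x‖ * f x)
  rw [(MeasurableEmbedding.subtype_coe (measurableSet_singleton (0 : E)).compl).map_comap,
    Subtype.range_coe, restrict_compl_singleton] at h4
  refine Eq.trans ?_ (h4.trans ?_)
  · rfl
  · refine lintegral_congr fun x ↦ ?_
    have hx : ‖x.1‖ ≠ 0 := norm_ne_zero_iff.2 x.2
    simp [smul_smul, hx, mul_comm]

lemma lintegral_resample [Nontrivial E] (f : E → ENNReal) (hf : Measurable f) :
    ∫⁻ z, f ((‖z.2‖ / ‖z.1‖) • z.1)
      ∂(ProbabilityTheory.stdGaussian E).prod (ProbabilityTheory.stdGaussian E) =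
    ∫⁻ x, f x ∂ProbabilityTheory.stdGaussian E := by
  obtain ⟨g, hg, h⟩ := exists_lintegral_polar E
  have hm : Measurable fun z : E × E ↦ f ((‖z.2‖ / ‖z.1‖) • z.1) := by fun_prop
  rw [lintegral_prod _ hm.aemeasurable, h _ (by fun_prop), h f hf]
  set ν := Measure.volumeIoiPow (Module.finrank ℝ E - 1)
  set σ := (volume : Measure E).toSphere
  have h1 : σ univ * ∫⁻ r, g r.1 ∂ν = 1 := by
    have := h (fun _ ↦ 1) measurable_const
    simpa [mul_comm] using this.symm
  have h2 : ∀ (u : Metric.sphere (0 : E) 1) (r : Ioi (0 : ℝ)),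
      ∫⁻ y, f ((‖y‖ / ‖r.1 • u.1‖) • (r.1 • u.1)) ∂ProbabilityTheory.stdGaussian E =
        (∫⁻ s, f (s.1 • u.1) * g s.1 ∂ν) * σ univ := by
    intro u r
    rw [h _ (by fun_prop)]
    have hr : r.1 ≠ 0 := ne_of_gt r.2
    have : ∀ (v : Metric.sphere (0 : E) 1) (s : Ioi (0 : ℝ)),
        f ((‖s.1 • v.1‖ / ‖r.1 • u.1‖) • (r.1 • u.1)) = f (s.1 • u.1) := by
      intro v s
      have hs : 0 < s.1 := s.2
      have hr' : 0 < r.1 := r.2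
      rw [smul_smul, norm_smul, norm_smul]
      simp [abs_of_pos hs, abs_of_pos hr', hr]
    simp_rw [this]
    simp
  simp_rw [h2]
  refine lintegral_congr fun u ↦ ?_
  rw [lintegral_const_mul _ (by fun_prop), mul_assoc, h1, mul_one]

lemma map_resample [Nontrivial E] :
    ((ProbabilityTheory.stdGaussian E).prod (ProbabilityTheory.stdGaussian E)).map
      (fun z ↦ (‖z.2‖ / ‖z.1‖) • z.1) = ProbabilityTheory.stdGaussian E := by
  ext s hs
  have hm : Measurable fun z : E × E ↦ (‖z.2‖ / ‖z.1‖) • z.1 := by fun_prop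
  have := lintegral_resample E (s.indicator 1) (measurable_one.indicator hs)
  rw [lintegral_indicator_one hs] at this
  rw [Measure.map_apply hm hs, ← this, ← lintegral_indicator_one (hm hs)]
  rfl

lemma map_rotation_stdGaussian (θ : ℝ) :
    ((ProbabilityTheory.stdGaussian E).prod (ProbabilityTheory.stdGaussian E)).map
      (ContinuousLinearMap.rotation θ) =
    (ProbabilityTheory.stdGaussian E).prod (ProbabilityTheory.stdGaussian E) :=
  IsGaussian.map_rotation_eq_self_of_forall_strongDual_eq_zero
    (fun L ↦ integral_strongDual_stdGaussian L) θ

end Density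

lemma gaussianReal_abs_le {v : NNReal} (hv : v ≠ 0) {s : ℝ} :
    gaussianReal 0 v {x | |x| ≤ s} ≤ ENNReal.ofReal (s / √v) := by
  rw [gaussianReal_apply _ hv]
  have hv0 : (0 : ℝ) < v := NNReal.coe_pos.2 (pos_iff_ne_zero.2 hv)
  have hset : {x : ℝ | |x| ≤ s} = Icc (-s) s := by ext; simp [abs_le]
  have hb : ∀ x : ℝ, gaussianPDF 0 v x ≤ ENNReal.ofReal (1 / (2 * √v)) := by
    intro x
    refine ENNReal.ofReal_le_ofReal ?_
    rw [gaussianPDFReal_def]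
    have h1 : exp (-(x - 0) ^ 2 / (2 * v)) ≤ 1 := exp_le_one_iff.2 (by
      rw [neg_div]; exact neg_nonpos.2 (by positivity))
    have h2 : 2 * √v ≤ √(2 * π * v) := by
      refine le_sqrt_of_sq_le ?_
      rw [mul_pow, sq_sqrt hv0.le]
      nlinarith [pi_gt_three]
    calc (√(2 * π * v))⁻¹ * exp (-(x - 0) ^ 2 / (2 * v)) ≤ (√(2 * π * v))⁻¹ * 1 := by gcongr
      _ ≤ (2 * √v)⁻¹ := by rw [mul_one]; gcongr
      _ = 1 / (2 * √v) := by rw [one_div]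
  calc ∫⁻ x in {x : ℝ | |x| ≤ s}, gaussianPDF 0 v x
      ≤ ∫⁻ _ in {x : ℝ | |x| ≤ s}, ENNReal.ofReal (1 / (2 * √v)) :=
        lintegral_mono fun x ↦ hb x
    _ = ENNReal.ofReal (s / √v) := by
      rw [setLIntegral_const, hset, Real.volume_Icc, ← ENNReal.ofReal_mul (by positivity)]
      congr 1
      field_simp
      ring

section Concentration

lemma map_inner_stdGaussian {n : ℕ} (x : EuclideanSpace ℝ (Fin n)) :
    (ProbabilityTheory.stdGaussian (EuclideanSpace ℝ (Fin n))).map (fun y ↦ inner ℝ x y) =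
      gaussianReal 0 (‖x‖ ^ 2).toNNReal := by
  have := IsGaussian.map_eq_gaussianReal (μ := ProbabilityTheory.stdGaussian
    (EuclideanSpace ℝ (Fin n))) (innerSL ℝ x)
  rwa [integral_strongDual_stdGaussian, variance_dual_stdGaussian, innerSL_apply_norm] at this

lemma exists_norm_sq_concentration :
    ∃ V : ℝ, 0 < V ∧ ∀ n : ℕ, 0 < n →
      (ProbabilityTheory.stdGaussian (EuclideanSpace ℝ (Fin n))).real
        {x | (n : ℝ) / 2 ≤ |‖x‖ ^ 2 - n|} ≤ V / n := by
  have hmem : MemLp (fun x : ℝ ↦ x ^ 2) 2 (gaussianReal 0 1) := by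
    have := (memLp_id_gaussianReal' (μ := 0) (v := 1) 4 (by simp)).norm_rpow_div 2
    rw [show (4 : ENNReal) / 2 = 2 by
      rw [show (4 : ENNReal) = 2 * 2 by norm_num, ENNReal.mul_div_cancel_right (by simp) (by simp)]]
      at this
    simpa using this
  have hmean : ∫ x : ℝ, x ^ 2 ∂gaussianReal 0 1 = 1 := by
    have h := variance_eq_sub (memLp_id_gaussianReal (μ := 0) (v := 1) 2)
    rw [variance_id_gaussianReal] at h
    simpa using h.symm
  set W : ℝ := Var[fun x : ℝ ↦ x ^ 2; gaussianReal 0 1] with hW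
  have hW0 : 0 ≤ W := variance_nonneg _ _
  refine ⟨4 * W + 1, by positivity, fun n hn ↦ ?_⟩
  have hn' : (0 : ℝ) < n := by exact_mod_cast hn
  set P := Measure.pi fun _ : Fin n ↦ gaussianReal 0 1 with hP
  set S : (Fin n → ℝ) → ℝ := ∑ i, fun ω ↦ (fun x : ℝ ↦ x ^ 2) (ω i) with hS
  have hi : ∀ i : Fin n, MemLp (fun ω : Fin n → ℝ ↦ (fun x : ℝ ↦ x ^ 2) (ω i)) 2 P := fun i ↦
    hmem.comp_measurePreserving (measurePreserving_eval _ i)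
  have hSmem : MemLp S 2 P := memLp_finsetSum' _ fun i _ ↦ hi i
  have hvar : Var[S; P] = n * W := by
    rw [hS, hP, variance_sum_pi fun _ ↦ hmem]
    simp [hW]
  have hES : ∫ ω, S ω ∂P = n := by
    simp only [hS, Finset.sum_apply]
    rw [integral_finsetSum _ fun i _ ↦ (hi i).integrable (by norm_num)]
    have : ∀ i : Fin n, ∫ ω : Fin n → ℝ, ω i ^ 2 ∂P = 1 := by
      intro i
      rw [← hmean, ← (measurePreserving_eval (fun _ : Fin n ↦ gaussianReal 0 1) i).map_eq,
        integral_map (measurable_pi_apply i).aemeasurable (by fun_prop)]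
    simp [this]
  have hch := meas_ge_le_variance_div_sq hSmem (c := n / 2) (by positivity)
  rw [hES, hvar] at hch
  have hset : (ProbabilityTheory.stdGaussian (EuclideanSpace ℝ (Fin n)))
      {x | (n : ℝ) / 2 ≤ |‖x‖ ^ 2 - n|} = P {ω | (n : ℝ) / 2 ≤ |S ω - n|} := by
    rw [← map_pi_eq_stdGaussian, Measure.map_apply (by fun_prop)
      (measurableSet_le (by fun_prop) (by fun_prop))]
    congr 1
    ext ω
    simp [EuclideanSpace.norm_sq_eq, hS]
  rw [measureReal_def, hset]
  refine ENNReal.toReal_le_of_le_ofReal (by positivity) (hch.trans (ENNReal.ofReal_le_ofReal ?_))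
  rw [div_le_div_iff₀ (by positivity) hn']
  nlinarith [sq_nonneg (n : ℝ)]

lemma sq_measure_annulus_le {n : ℕ} (hn : 0 < n) {a b : ℝ} (ha : 0 ≤ a) (hab : a ≤ b) :
    (ProbabilityTheory.stdGaussian (EuclideanSpace ℝ (Fin n))).real {x | a < ‖x‖ ∧ ‖x‖ < b} ^ 2 ≤
      (ProbabilityTheory.stdGaussian (EuclideanSpace ℝ (Fin n))).real
        {x | (n : ℝ) / 2 ≤ |‖x‖ ^ 2 - n|} + (b ^ 2 - a ^ 2) / √n := by
  set μ := ProbabilityTheory.stdGaussian (EuclideanSpace ℝ (Fin n)) with hμ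
  have hn' : (0 : ℝ) < n := by exact_mod_cast hn
  set t := b ^ 2 - a ^ 2 with ht
  have ht0 : 0 ≤ t := by rw [ht]; nlinarith
  set T : Set (EuclideanSpace ℝ (Fin n)) := {x | (n : ℝ) / 2 ≤ |‖x‖ ^ 2 - n|} with hT
  have hTm : MeasurableSet T := measurableSet_le (by fun_prop) (by fun_prop)
  set I : Set (EuclideanSpace ℝ (Fin n)) := {x | a < ‖x‖ ∧ ‖x‖ < b} with hI
  set D : Set (EuclideanSpace ℝ (Fin n) × EuclideanSpace ℝ (Fin n)) :=
    {z | |‖z.1‖ ^ 2 - ‖z.2‖ ^ 2| ≤ t} with hD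
  have hDm : MeasurableSet D := measurableSet_le (by fun_prop) (by fun_prop)
  have h1 : (μ.prod μ) (I ×ˢ I) ≤ (μ.prod μ) D := by
    refine measure_mono ?_
    rintro ⟨x, y⟩ ⟨⟨hx1, hx2⟩, hy1, hy2⟩
    simp only [hD, mem_ofPred_eq, abs_le] at *
    constructor <;> nlinarith
  have h2 : (μ.prod μ) D = (μ.prod μ) {z | |2 * inner ℝ z.1 z.2| ≤ t} := by
    conv_lhs => rw [← map_rotation_stdGaussian _ (π / 4)]
    rw [Measure.map_apply (ContinuousLinearMap.continuous _).measurable hDm]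
    congr 1
    ext z
    simp only [hD, mem_preimage, mem_ofPred_eq, ContinuousLinearMap.rotation_apply]
    have hc : cos (π / 4) ^ 2 = 1 / 2 := by
      rw [cos_pi_div_four, div_pow, sq_sqrt (by norm_num)]; norm_num
    have hs : sin (π / 4) = cos (π / 4) := by rw [cos_pi_div_four, sin_pi_div_four]
    rw [hs, norm_add_sq_real, norm_add_sq_real]
    simp only [norm_smul, inner_smul_left, inner_smul_right, mul_pow, norm_neg, norm_eq_abs,
      sq_abs, hc, conj_trivial]
    have : ∀ w : ℝ, 2 * (cos (π / 4) * (cos (π / 4) * w)) = w := fun w ↦ by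
      linear_combination 2 * w * hc
    rw [this]
    have h' : ∀ w : ℝ, 2 * (cos (π / 4) * (-cos (π / 4) * w)) = -w := fun w ↦ by
      linear_combination -2 * w * hc
    simp only [h']
    ring_nf
  have h3 : ∀ x, μ {y | |2 * inner ℝ x y| ≤ t} ≤ T.indicator 1 x + ENNReal.ofReal (t / √n) := by
    intro x
    by_cases hx : x ∈ T
    · exact le_add_right (by simpa [hx] using prob_le_one)
    have hx2 : (n : ℝ) / 2 ≤ ‖x‖ ^ 2 := by
      simp only [hT, mem_ofPred_eq, not_le, abs_lt] at hx
      linarith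
    have hx0 : (‖x‖ ^ 2).toNNReal ≠ 0 := by
      simpa using fun h : x = 0 ↦ by simp [h] at hx2; linarith
    refine le_add_left ?_
    have h4 := gaussianReal_abs_le hx0 (s := t / 2)
    rw [← map_inner_stdGaussian, Measure.map_apply (by fun_prop)
      (measurableSet_le (by fun_prop) (by fun_prop))] at h4
    have h5 : {y | |2 * inner ℝ x y| ≤ t} =
        (fun y ↦ inner ℝ x y) ⁻¹' {x : ℝ | |x| ≤ t / 2} := by
      ext y
      simp only [mem_ofPred_eq, mem_preimage, abs_mul, abs_two]
      rw [le_div_iff₀ (by norm_num), mul_comm]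
    rw [h5]
    refine h4.trans (ENNReal.ofReal_le_ofReal ?_)
    rw [coe_toNNReal _ (by positivity), sqrt_sq (norm_nonneg _), div_div]
    gcongr
    refine sqrt_le_iff.2 ⟨by positivity, ?_⟩
    nlinarith
  have h6 : (μ.prod μ) D ≤ μ T + ENNReal.ofReal (t / √n) := by
    rw [h2, Measure.prod_apply (measurableSet_le (by fun_prop) (by fun_prop))]
    calc _ ≤ ∫⁻ x, (T.indicator 1 x + ENNReal.ofReal (t / √n)) ∂μ := lintegral_mono h3
      _ = μ T + ENNReal.ofReal (t / √n) := by
        rw [lintegral_add_right _ measurable_const, lintegral_indicator_one hTm]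
        simp
  have h7 := h1.trans h6
  rw [Measure.prod_prod] at h7
  have h8 := ENNReal.toReal_mono (by finiteness) h7
  rw [ENNReal.toReal_mul, ENNReal.toReal_add (by finiteness) (by finiteness),
    ENNReal.toReal_ofReal (by positivity)] at h8
  rw [sq]
  exact h8

end Concentration

lemma step_arithmetic {s κ t₁ t₂ N δ u v d q : ℝ} (hs : 0 < s) (hκ : 0 < κ)
    (ht₁ : 0 ≤ t₁) (h12 : t₁ + 2 * κ ≤ t₂) (ht₂ : t₂ ≤ 2 * s) (hN : 50 * s / κ ≤ N)
    (hNδ : N * δ = π / 2) (hq : 0 ≤ q) (hd : 0 ≤ d) (hu : s / 2 ≤ u)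
    (huv : u - d ≤ t₁ * (v + q)) (hvu : t₂ * v ≤ u) (hdδ : d ≤ δ * (5 / 2 * s))
    (hqδ : t₂ * q ≤ δ * (35 / 4 * s)) : False := by
  have ht₂0 : 0 < t₂ := by linarith
  have e3 : t₂ * u - t₂ * d ≤ t₁ * u + t₁ * (t₂ * q) := by
    calc t₂ * u - t₂ * d = t₂ * (u - d) := by ring
      _ ≤ t₂ * (t₁ * (v + q)) := by gcongr
      _ = t₁ * (t₂ * v) + t₁ * (t₂ * q) := by ring
      _ ≤ _ := by gcongr
  have e4 : t₂ * d ≤ 2 * s * (δ * (5 / 2 * s)) := by gcongr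
  have e5 : t₁ * (t₂ * q) ≤ 2 * s * (δ * (35 / 4 * s)) :=
    mul_le_mul (by linarith) hqδ (by positivity) (by positivity)
  have e6 : 2 * κ * (s / 2) ≤ (t₂ - t₁) * u :=
    mul_le_mul (by linarith) hu (by positivity) (by linarith)
  have e7 : κ * s ≤ 45 / 2 * δ * s * s := by linarith
  have e8 : κ ≤ 45 / 2 * δ * s := le_of_mul_le_mul_right e7 hs
  have e9 : 50 * s ≤ N * κ := by rwa [div_le_iff₀ hκ] at hN
  have hN0 : 0 ≤ N := le_trans (by positivity) hN
  have e10 : N * κ ≤ 45 / 2 * (π / 2) * s := by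
    have := mul_le_mul_of_nonneg_left e8 hN0
    calc N * κ ≤ N * (45 / 2 * δ * s) := this
      _ = 45 / 2 * (N * δ) * s := by ring
      _ = _ := by rw [hNδ]
  nlinarith [pi_lt_d2]

section Cone

variable {E : Type*} [NormedAddCommGroup E] [NormedSpace ℝ E]

/-- The cone of directions in which the unit ball of `p` extends beyond radius `t`. -/
def cone (p : Seminorm ℝ E) (t : ℝ) : Set E := {x | t * p x < ‖x‖}

lemma cone_anti (p : Seminorm ℝ E) {s t : ℝ} (h : s ≤ t) : cone p t ⊆ cone p s := fun x hx ↦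
  (mul_le_mul_of_nonneg_right h (apply_nonneg p x)).trans_lt hx

lemma measurableSet_cone [MeasurableSpace E] [BorelSpace E] {p : Seminorm ℝ E} (hp : Continuous p) (t : ℝ) :
    MeasurableSet (cone p t) :=
  measurableSet_lt (by have := hp.measurable; fun_prop) (by fun_prop)

set_option maxHeartbeats 400000 in
lemma exists_mem_cone_diff (p : Seminorm ℝ E) {s κ t₁ t₂ : ℝ} (hs : 0 < s) (hκ : 0 < κ)
    (ht₁ : 0 ≤ t₁) (h12 : t₁ + 2 * κ ≤ t₂) (ht₂ : t₂ ≤ 2 * s) {N : ℕ} (hN : 50 * s / κ ≤ N)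
    {x y : E} (hx : x ∈ cone p t₂) (hy : y ∉ cone p t₁)
    {α : ℝ} (hα : 1 / 2 ≤ sin α) (hxy : cos α • x + sin α • y ∈ cone p t₂)
    (hnorm : ∀ j ≤ N, s ^ 2 / 2 < ‖cos (j * (π / (2 * N))) • x + sin (j * (π / (2 * N))) • y‖ ^ 2 ∧
      ‖cos (j * (π / (2 * N))) • x + sin (j * (π / (2 * N))) • y‖ ^ 2 < 3 / 2 * s ^ 2) :
    ∃ j ≤ N, cos (j * (π / (2 * N))) • x + sin (j * (π / (2 * N))) • y ∈
      cone p t₁ \ cone p t₂ := by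
  have hN0 : (0 : ℝ) < N := lt_of_lt_of_le (by positivity) hN
  set δ : ℝ := π / (2 * N) with hδ
  have hδ0 : 0 < δ := by positivity
  have hNδ : N * δ = π / 2 := by rw [hδ]; field_simp
  set X : ℕ → E := fun j ↦ cos (j * δ) • x + sin (j * δ) • y with hX
  have hX0 : X 0 = x := by simp [hX]
  have hXN : X N = y := by simp [hX, hNδ]
  by_contra! hcon
  have hex : ∃ j, X j ∉ cone p t₂ := ⟨N, by
    rw [hXN]; exact fun h ↦ hy (cone_anti p (by linarith) h)⟩
  classical
  set j := Nat.find hex with hj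
  have hjN : j ≤ N := Nat.find_min' hex (by
    rw [hXN]; exact fun h ↦ hy (cone_anti p (by linarith) h))
  have hj2 : X j ∉ cone p t₂ := Nat.find_spec hex
  have hj0 : j ≠ 0 := fun h ↦ hj2 (by rw [h, hX0]; exact hx)
  obtain ⟨i, hi⟩ := Nat.exists_eq_succ_of_ne_zero hj0
  have hi2 : X i ∈ cone p t₂ := by
    by_contra h
    have := Nat.find_min' hex h
    omega
  have hj1 : X j ∉ cone p t₁ := fun h ↦ hcon j hjN ⟨h, hj2⟩
  have bound : ∀ k ≤ N, ‖X k‖ < 5 / 4 * s := fun k hk ↦ by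
    have := (hnorm k hk).2
    exact lt_of_pow_lt_pow_left₀ 2 (by positivity) (by nlinarith [sq_nonneg s])
  have hxn : ‖x‖ < 5 / 4 * s := by simpa [hX0] using bound 0 (by omega)
  have hyn : ‖y‖ < 5 / 4 * s := by simpa [hXN] using bound N le_rfl
  have hin : s / 2 ≤ ‖X i‖ := by
    have := (hnorm i (by omega)).1
    exact (lt_of_pow_lt_pow_left₀ 2 (by positivity) (by nlinarith [sq_pos_of_pos hs])).le
  have ht₂0 : 0 < t₂ := by linarith
  have hpx : t₂ * p x < 5 / 4 * s := lt_trans hx hxn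
  have hpα : t₂ * p (cos α • x + sin α • y) < 5 / 2 * s := by
    refine lt_of_lt_of_le hxy ((norm_add_le _ _).trans ?_)
    rw [norm_smul, norm_smul]
    have := mul_le_mul_of_nonneg_right (abs_cos_le_one α) (norm_nonneg x)
    have := mul_le_mul_of_nonneg_right (abs_sin_le_one α) (norm_nonneg y)
    simp only [norm_eq_abs]
    linarith
  have hpy : t₂ * p y < 15 / 2 * s := by
    have h1 : sin α * p y ≤ p (cos α • x + sin α • y) + p x := by
      have h2 : p (sin α • y) ≤ p (cos α • x + sin α • y) + p (cos α • x) := by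
        have := map_sub_le_add p (cos α • x + sin α • y) (cos α • x)
        rwa [add_sub_cancel_left] at this
      rw [map_smul_eq_mul, map_smul_eq_mul, norm_eq_abs, norm_eq_abs,
        abs_of_pos (a := sin α) (by linarith)] at h2
      have := mul_le_mul_of_nonneg_right (abs_cos_le_one α) (apply_nonneg p x)
      linarith
    have h3 : p y / 2 ≤ sin α * p y := by nlinarith [apply_nonneg p y]
    nlinarith
  have hstep : X j - X i = (cos (j * δ) - cos (i * δ)) • x + (sin (j * δ) - sin (i * δ)) • y := by
    simp only [hX, sub_smul]; abel
  have hd : (j : ℝ) * δ - i * δ = δ := by rw [hi]; push_cast; ring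
  have hc : |cos (j * δ) - cos (i * δ)| ≤ δ := by
    have := abs_cos_sub_cos_le (j * δ) (i * δ)
    rwa [hd, abs_of_pos hδ0] at this
  have hs' : |sin (j * δ) - sin (i * δ)| ≤ δ := by
    have := abs_sin_sub_sin_le (j * δ) (i * δ)
    rwa [hd, abs_of_pos hδ0] at this
  have hΔ : ‖X j - X i‖ ≤ δ * (5 / 2 * s) := by
    rw [hstep]
    refine (norm_add_le _ _).trans ?_
    rw [norm_smul, norm_smul, norm_eq_abs, norm_eq_abs]
    have := mul_le_mul hc hxn.le (norm_nonneg x) hδ0.le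
    have := mul_le_mul hs' hyn.le (norm_nonneg y) hδ0.le
    linarith
  have hpΔ : t₂ * p (X j - X i) ≤ δ * (35 / 4 * s) := by
    have h1 : p (X j - X i) ≤ δ * (p x + p y) := by
      rw [hstep]
      refine (map_add_le_add p _ _).trans ?_
      rw [map_smul_eq_mul, map_smul_eq_mul, norm_eq_abs, norm_eq_abs]
      have := mul_le_mul_of_nonneg_right hc (apply_nonneg p x)
      have := mul_le_mul_of_nonneg_right hs' (apply_nonneg p y)
      linarith
    calc t₂ * p (X j - X i) ≤ t₂ * (δ * (p x + p y)) := by gcongr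
      _ = δ * (t₂ * p x + t₂ * p y) := by ring
      _ ≤ δ * (35 / 4 * s) := by gcongr; linarith
  have hnj : ‖X i‖ - ‖X j - X i‖ ≤ ‖X j‖ := by
    have := norm_sub_norm_le (X i) (X i - X j)
    rw [sub_sub_cancel, norm_sub_rev] at this
    exact this
  have hpj : p (X j) ≤ p (X i) + p (X j - X i) := by
    have := map_add_le_add p (X i) (X j - X i)
    rwa [add_sub_cancel] at this
  have e1 : ‖X j‖ ≤ t₁ * p (X j) := not_lt.1 hj1
  have e2 : t₂ * p (X i) < ‖X i‖ := hi2
  exact step_arithmetic hs hκ ht₁ h12 ht₂ hN hNδ (apply_nonneg p _) (norm_nonneg _) hin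
    (hnj.trans (e1.trans (by gcongr))) e2.le hΔ hpΔ

end Cone

section Path

variable {E : Type*} [NormedAddCommGroup E] [InnerProductSpace ℝ E] [FiniteDimensional ℝ E]
  [MeasurableSpace E] [BorelSpace E]

lemma measure_isolated_le {A : Set E} (hA : MeasurableSet A) :
    ((ProbabilityTheory.stdGaussian E).prod (ProbabilityTheory.stdGaussian E)).real
      {z | z.1 ∈ A ∧ ∀ k ∈ Finset.Icc 1 5,
        cos ((k : ℕ) * (π / 6)) • z.1 + sin (k * (π / 6)) • z.2 ∉ A} ≤ 1 / 6 := by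
  set P := (ProbabilityTheory.stdGaussian E).prod (ProbabilityTheory.stdGaussian E)
  set S : Set (E × E) := {z | z.1 ∈ A ∧ ∀ k ∈ Finset.Icc 1 5,
        cos ((k : ℕ) * (π / 6)) • z.1 + sin (k * (π / 6)) • z.2 ∉ A} with hS
  have hSm : MeasurableSet S := by
    have e : S = Prod.fst ⁻¹' A ∩ ⋂ k ∈ Finset.Icc 1 5,
        {z : E × E | cos ((k : ℕ) * (π / 6)) • z.1 + sin (k * (π / 6)) • z.2 ∈ Aᶜ} := by
      ext z; simp [hS]
    rw [e]
    refine (measurable_fst hA).inter ?_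
    refine MeasurableSet.iInter fun k ↦ MeasurableSet.iInter fun _ ↦ ?_
    exact (show Measurable fun z : E × E ↦
      cos ((k : ℕ) * (π / 6)) • z.1 + sin (k * (π / 6)) • z.2 by fun_prop) hA.compl
  set R : ℕ → E × E → E × E := fun i ↦ ContinuousLinearMap.rotation (i * (π / 6))
  have hR : ∀ i, Measurable (R i) := fun i ↦ (ContinuousLinearMap.continuous _).measurable
  have hP : ∀ i, P.real (R i ⁻¹' S) = P.real S := fun i ↦ by
    rw [measureReal_def, ← Measure.map_apply (hR i) hSm]
    simp only [R, P]
    rw [map_rotation_stdGaussian, measureReal_def]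
  have hdisj : ∀ i j, i < j → j < 6 → Disjoint (R i ⁻¹' S) (R j ⁻¹' S) := by
    intro i j hij hj
    rw [Set.disjoint_left]
    intro z hi hj'
    refine hi.2 (j - i) (by simp; omega) ?_
    convert! hj'.1 using 1
    simp only [R, ContinuousLinearMap.rotation_apply]
    have e : (j : ℝ) * (π / 6) = i * (π / 6) + ((j - i : ℕ) : ℝ) * (π / 6) := by
      rw [Nat.cast_sub hij.le]; ring
    rw [e, cos_add, sin_add]
    module
  have hsum : ∑ i ∈ Finset.range 6, P.real (R i ⁻¹' S) ≤ 1 := by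
    rw [← measureReal_biUnion_finset _ fun i _ ↦ hR i hSm]
    · exact measureReal_le_one
    · intro i hi j hj hij
      rw [Finset.mem_coe, Finset.mem_range] at hi hj
      rcases lt_or_gt_of_ne hij with h | h
      · exact hdisj i j h hj
      · exact (hdisj j i h hi).symm
  simp only [hP, Finset.sum_const, Finset.card_range, nsmul_eq_mul] at hsum
  push_cast at hsum
  linarith

lemma measure_rotate_fst {B : Set E} (hB : MeasurableSet B) (θ : ℝ) :
    ((ProbabilityTheory.stdGaussian E).prod (ProbabilityTheory.stdGaussian E)).real
      {z | cos θ • z.1 + sin θ • z.2 ∈ B} = (ProbabilityTheory.stdGaussian E).real B := by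
  have h : {z : E × E | cos θ • z.1 + sin θ • z.2 ∈ B} =
      ContinuousLinearMap.rotation θ ⁻¹' (B ×ˢ univ) := by
    ext z; simp [ContinuousLinearMap.rotation_apply]
  rw [h, measureReal_def, ← Measure.map_apply (ContinuousLinearMap.continuous _).measurable
    (hB.prod .univ), map_rotation_stdGaussian, Measure.prod_prod, measure_univ, mul_one,
    measureReal_def]

lemma half_le_sin_of_mem_Icc {k : ℕ} (hk : k ∈ Finset.Icc 1 5) : 1 / 2 ≤ sin (k * (π / 6)) := by
  rw [Finset.mem_Icc] at hk
  have h1 : (1 : ℝ) ≤ k := by exact_mod_cast hk.1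
  have h2 : (k : ℝ) ≤ 5 := by exact_mod_cast hk.2
  rw [← cos_pi_div_three, ← cos_sub_pi_div_two, ← cos_abs (k * (π / 6) - π / 2)]
  refine cos_le_cos_of_nonneg_of_le_pi (abs_nonneg _) (by linarith [pi_pos]) (abs_le.2 ⟨?_, ?_⟩)
  · nlinarith [pi_pos]
  · nlinarith [pi_pos]

lemma cone_measure_le (p : Seminorm ℝ E) (hp : Continuous p) {s κ t₁ t₂ : ℝ} (hs : 0 < s)
    (hκ : 0 < κ) (ht₁ : 0 ≤ t₁) (h12 : t₁ + 2 * κ ≤ t₂) (ht₂ : t₂ ≤ 2 * s) {N : ℕ}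
    (hN : 50 * s / κ ≤ N) :
    (ProbabilityTheory.stdGaussian E).real (cone p t₂) *
        (1 - (ProbabilityTheory.stdGaussian E).real (cone p t₁)) ≤
      1 / 6 + (N + 1) * ((ProbabilityTheory.stdGaussian E).real (cone p t₁ \ cone p t₂) +
        (ProbabilityTheory.stdGaussian E).real {x | s ^ 2 / 2 ≤ |‖x‖ ^ 2 - s ^ 2|}) := by
  have hcone := measurableSet_cone hp
  set μ := ProbabilityTheory.stdGaussian E
  set T : Set E := {x | s ^ 2 / 2 ≤ |‖x‖ ^ 2 - s ^ 2|} with hT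
  have hTm : MeasurableSet T := measurableSet_le (by fun_prop) (by fun_prop)
  set S : Set (E × E) := {z | z.1 ∈ cone p t₂ ∧ ∀ k ∈ Finset.Icc 1 5,
        cos ((k : ℕ) * (π / 6)) • z.1 + sin (k * (π / 6)) • z.2 ∉ cone p t₂} with hS
  set B : Set E := (cone p t₁ \ cone p t₂) ∪ T with hB
  have hBm : MeasurableSet B := ((hcone _).diff (hcone _)).union hTm
  have hsub : cone p t₂ ×ˢ (cone p t₁)ᶜ ⊆ S ∪ ⋃ j ∈ Finset.range (N + 1),
      {z : E × E | cos ((j : ℕ) * (π / (2 * N))) • z.1 + sin (j * (π / (2 * N))) • z.2 ∈ B} := by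
    rintro ⟨x, y⟩ ⟨hx, hy⟩
    by_cases hzS : (x, y) ∈ S
    · exact Or.inl hzS
    refine Or.inr ?_
    have hx' : x ∈ cone p t₂ := hx
    simp only [hS, mem_ofPred_eq, not_and, not_forall, not_not] at hzS
    obtain ⟨k, hk, hkm⟩ := hzS hx
    simp only [mem_iUnion, Finset.mem_range, mem_ofPred_eq]
    by_contra! hcon
    obtain ⟨j, hj, hjm⟩ := exists_mem_cone_diff p hs hκ ht₁ h12 ht₂ hN hx' hy
      (half_le_sin_of_mem_Icc hk) hkm (fun j hj ↦ by
        have := hcon j (by omega)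
        simp only [hB, hT, mem_union, mem_ofPred_eq, not_or, not_le, abs_lt] at this
        constructor <;> linarith [this.2.1, this.2.2])
    exact hcon j (by omega) (Or.inl hjm)
  calc μ.real (cone p t₂) * (1 - μ.real (cone p t₁))
      = (μ.prod μ).real (cone p t₂ ×ˢ (cone p t₁)ᶜ) := by
        rw [measureReal_prod_prod, probReal_compl_eq_one_sub (hcone _)]
    _ ≤ (μ.prod μ).real S + ∑ j ∈ Finset.range (N + 1), (μ.prod μ).real
        {z : E × E | cos ((j : ℕ) * (π / (2 * N))) • z.1 + sin (j * (π / (2 * N))) • z.2 ∈ B} :=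
        (measureReal_mono hsub).trans ((measureReal_union_le _ _).trans
          (add_le_add le_rfl (measureReal_biUnion_finset_le _ _)))
    _ = (μ.prod μ).real S + (N + 1) * μ.real B := by
        rw [Finset.sum_congr rfl fun j _ ↦ measure_rotate_fst hBm _]
        simp [μ]
    _ ≤ _ := by
        gcongr
        · exact measure_isolated_le (hcone _)
        · exact measureReal_union_le _ _

end Path

section Agreement

variable {E : Type*} [NormedAddCommGroup E] [InnerProductSpace ℝ E] [FiniteDimensional ℝ E]
  [MeasurableSpace E] [BorelSpace E]

lemma ae_ne_zero_stdGaussian [Nontrivial E] :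
    ∀ᵐ x ∂ProbabilityTheory.stdGaussian E, x ≠ 0 :=
  (stdGaussian_absolutelyContinuous E).ae_le (Measure.ae_ne volume 0)

lemma ae_fst_ne_zero_stdGaussian [Nontrivial E] :
    ∀ᵐ z ∂(ProbabilityTheory.stdGaussian E).prod (ProbabilityTheory.stdGaussian E), z.1 ≠ 0 :=
  Measure.quasiMeasurePreserving_fst.ae ae_ne_zero_stdGaussian

/-- The standard Gaussian measure, computed by drawing direction and radius independently. -/
lemma stdGaussian_real_resample [Nontrivial E] (p : Seminorm ℝ E)
    {Q : ℝ → Prop → Prop} (hQ : MeasurableSet {x : E | Q ‖x‖ (p x < 1)}) :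
    (ProbabilityTheory.stdGaussian E).real {x | Q ‖x‖ (p x < 1)} =
      ((ProbabilityTheory.stdGaussian E).prod (ProbabilityTheory.stdGaussian E)).real
        {z | Q ‖z.2‖ (‖z.2‖ * p z.1 < ‖z.1‖)} := by
  conv_lhs => rw [← map_resample E]
  rw [measureReal_def, Measure.map_apply (by fun_prop) hQ, measureReal_def]
  congr 1
  refine measure_congr ?_
  filter_upwards [ae_fst_ne_zero_stdGaussian (E := E)] with z hz
  have h0 : 0 < ‖z.1‖ := norm_pos_iff.2 hz
  have h1 : ‖(‖z.2‖ / ‖z.1‖) • z.1‖ = ‖z.2‖ := by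
    rw [norm_smul, norm_div, norm_norm, norm_norm, div_mul_cancel₀ _ h0.ne']
  have h2 : p ((‖z.2‖ / ‖z.1‖) • z.1) < 1 ↔ ‖z.2‖ * p z.1 < ‖z.1‖ := by
    rw [map_smul_eq_mul, norm_div, norm_norm, norm_norm, div_mul_eq_mul_div, div_lt_one h0]
  change Q ‖(‖z.2‖ / ‖z.1‖) • z.1‖ (p ((‖z.2‖ / ‖z.1‖) • z.1) < 1) =
    Q ‖z.2‖ (‖z.2‖ * p z.1 < ‖z.1‖)
  rw [h1, h2]

lemma cone_bounds_of_agreement [Nontrivial E] (p : Seminorm ℝ E) (hp : Continuous p)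
    {m t₁ t₂ ε : ℝ}
    (hm : (ProbabilityTheory.stdGaussian E).real {x | ‖x‖ ≤ m} = 1 / 2)
    (h₁ : 1 / 4 ≤ (ProbabilityTheory.stdGaussian E).real {x | ‖x‖ ≤ t₁})
    (h₂ : 1 / 4 ≤ (ProbabilityTheory.stdGaussian E).real {x | t₂ ≤ ‖x‖})
    (hU : (ProbabilityTheory.stdGaussian E).real {x | p x < 1} < 1 / 2 + ε)
    (hU' : (ProbabilityTheory.stdGaussian E).real {x | ¬ p x < 1} < 1 / 2 + ε)
    (hball : (ProbabilityTheory.stdGaussian E).real {x | ‖x‖ ≤ m ↔ p x < 1} < 1 / 2 + ε) :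
    (ProbabilityTheory.stdGaussian E).real (cone p t₁ \ cone p t₂) ≤ 4 * ε ∧
      1 / 2 - 6 * ε ≤ (ProbabilityTheory.stdGaussian E).real (cone p t₂) ∧
      (ProbabilityTheory.stdGaussian E).real (cone p t₁) ≤ 1 / 2 + 6 * ε := by
  have hpm : Measurable p := hp.measurable
  have hcone := measurableSet_cone hp
  have hUm : MeasurableSet {x : E | p x < 1} := measurableSet_lt hpm measurable_const
  have hYm : MeasurableSet {x : E | ‖x‖ ≤ m} := measurableSet_le measurable_norm measurable_const
  have hYUm : MeasurableSet {x : E | ‖x‖ ≤ m ↔ p x < 1} := hYm.iff hUm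
  rw [stdGaussian_real_resample p (Q := fun _ u ↦ u) hUm] at hU
  rw [stdGaussian_real_resample p (Q := fun _ u ↦ ¬ u) hUm.compl] at hU'
  rw [stdGaussian_real_resample p (Q := fun r u ↦ r ≤ m ↔ u) hYUm] at hball
  set μ := ProbabilityTheory.stdGaussian E
  set Y : Set E := {x | ‖x‖ ≤ m}
  set Z : Set (E × E) := {z | ‖z.2‖ * p z.1 < ‖z.1‖} with hZ
  have hZm : MeasurableSet Z := measurableSet_lt (by fun_prop) (by fun_prop)
  set W₁ : Set (E × E) := Prod.fst ⁻¹' (cone p m)ᶜ ∩ Z with hW₁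
  set W₂ : Set (E × E) := Prod.fst ⁻¹' (cone p m) ∩ Zᶜ with hW₂
  have hW₁m : MeasurableSet W₁ := (measurable_fst (hcone m).compl).inter hZm
  have hW₂m : MeasurableSet W₂ := (measurable_fst (hcone m)).inter hZm.compl
  have hq : μ.real (cone p m)ᶜ = 1 - μ.real (cone p m) := probReal_compl_eq_one_sub (hcone m)
  have hY' : μ.real Yᶜ = 1 / 2 := by rw [probReal_compl_eq_one_sub hYm, hm]; norm_num
  have key₁ : ∀ z ∈ W₁, z.2 ∈ Y := by
    rintro ⟨x, y⟩ ⟨hx, hz⟩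
    have hx' : ‖x‖ ≤ m * p x := not_lt.1 hx
    have hz' : ‖y‖ * p x < ‖x‖ := hz
    exact (lt_of_mul_lt_mul_right (hz'.trans_le hx') (apply_nonneg p x)).le
  have key₂ : ∀ z ∈ W₂, z.2 ∉ Y := by
    rintro ⟨x, y⟩ ⟨hx, hz⟩ hy
    have hx' : m * p x < ‖x‖ := hx
    have hz' : ‖x‖ ≤ ‖y‖ * p x := not_lt.1 hz
    have hy' : ‖y‖ ≤ m := hy
    nlinarith [apply_nonneg p x]
  have hW : (μ.prod μ).real W₁ + (μ.prod μ).real W₂ < ε := by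
    have hsub : (((cone p m)ᶜ ×ˢ Yᶜ ∪ cone p m ×ˢ Y) ∪ (W₁ ∪ W₂)) ⊆
        {z : E × E | ‖z.2‖ ≤ m ↔ ‖z.2‖ * p z.1 < ‖z.1‖} := by
      rintro ⟨x, y⟩ h
      rcases h with (⟨hx, hy⟩ | ⟨hx, hy⟩) | (h | h)
      · exact iff_of_false hy fun hz ↦ hy (key₁ (x, y) ⟨hx, hz⟩)
      · exact iff_of_true hy (by_contra fun hz ↦ key₂ (x, y) ⟨hx, hz⟩ hy)
      · exact iff_of_true (key₁ _ h) h.2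
      · exact iff_of_false (key₂ _ h) h.2
    have h := (measureReal_mono hsub (μ := μ.prod μ)).trans_lt hball
    rw [measureReal_union _ (hW₁m.union hW₂m), measureReal_union _ ((hcone m).prod hYm),
      measureReal_union _ hW₂m, measureReal_prod_prod, measureReal_prod_prod, hq, hY', hm] at h
    · linarith
    · exact Set.disjoint_left.2 fun z h h' ↦ h.1 h'.1
    · exact Set.disjoint_left.2 fun z h h' ↦ h.1 h'.1
    · refine Set.disjoint_left.2 fun z h h' ↦ ?_
      rcases h with h | h <;> rcases h' with h' | h'
      · exact h.2 (key₁ z h')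
      · exact h.1 h'.1
      · exact h'.1 h.1
      · exact key₂ z h' h.2
  have hd₁ : μ.real (cone p t₁ \ cone p m) ≤ 4 * (μ.prod μ).real W₁ := by
    have hsub : (cone p t₁ \ cone p m) ×ˢ {x : E | ‖x‖ ≤ t₁} ⊆ W₁ := by
      rintro ⟨x, y⟩ ⟨⟨hx, hx'⟩, hy⟩
      exact ⟨hx', (mul_le_mul_of_nonneg_right hy (apply_nonneg p x)).trans_lt hx⟩
    have h := measureReal_mono hsub (μ := μ.prod μ)
    rw [measureReal_prod_prod] at h
    nlinarith [measureReal_nonneg (μ := μ) (s := cone p t₁ \ cone p m)]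
  have hd₂ : μ.real (cone p m \ cone p t₂) ≤ 4 * (μ.prod μ).real W₂ := by
    have hsub : (cone p m \ cone p t₂) ×ˢ {x : E | t₂ ≤ ‖x‖} ⊆ W₂ := by
      rintro ⟨x, y⟩ ⟨⟨hx, hx'⟩, hy⟩
      exact ⟨hx, not_lt.2 ((not_lt.1 hx').trans
        (mul_le_mul_of_nonneg_right hy (apply_nonneg p x)))⟩
    have h := measureReal_mono hsub (μ := μ.prod μ)
    rw [measureReal_prod_prod] at h
    nlinarith [measureReal_nonneg (μ := μ) (s := cone p m \ cone p t₂)]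
  have hZ₁ : (μ.prod μ).real Z ≤ (μ.prod μ).real W₁ + μ.real (cone p m) := by
    have hsub : Z ⊆ W₁ ∪ cone p m ×ˢ univ := fun z hz ↦
      (em (z.1 ∈ cone p m)).elim (fun h ↦ Or.inr ⟨h, trivial⟩) fun h ↦ Or.inl ⟨h, hz⟩
    have h := (measureReal_mono hsub (μ := μ.prod μ)).trans (measureReal_union_le _ _)
    simpa [measureReal_prod_prod] using h
  have hZ₂ : (μ.prod μ).real Zᶜ ≤ (μ.prod μ).real W₂ + (1 - μ.real (cone p m)) := by
    have hsub : Zᶜ ⊆ W₂ ∪ (cone p m)ᶜ ×ˢ univ := fun z hz ↦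
      (em (z.1 ∈ cone p m)).elim (fun h ↦ Or.inl ⟨h, hz⟩) fun h ↦ Or.inr ⟨h, trivial⟩
    have h := (measureReal_mono hsub (μ := μ.prod μ)).trans (measureReal_union_le _ _)
    rw [← hq]
    simpa [measureReal_prod_prod] using h
  have hU₂ : (μ.prod μ).real Zᶜ < 1 / 2 + ε := hU'
  have hU₁ : (μ.prod μ).real Z < 1 / 2 + ε := hU
  have hZc : (μ.prod μ).real Zᶜ = 1 - (μ.prod μ).real Z := probReal_compl_eq_one_sub hZm
  have hW₁0 := measureReal_nonneg (μ := μ.prod μ) (s := W₁)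
  have hW₂0 := measureReal_nonneg (μ := μ.prod μ) (s := W₂)
  have hs : μ.real (cone p t₁ \ cone p t₂) ≤
      μ.real (cone p t₁ \ cone p m) + μ.real (cone p m \ cone p t₂) :=
    (measureReal_mono fun x hx ↦ (em (x ∈ cone p m)).elim (fun h ↦ Or.inr ⟨h, hx.2⟩)
      fun h ↦ Or.inl ⟨hx.1, h⟩).trans (measureReal_union_le _ _)
  have hs₂ : μ.real (cone p m) ≤ μ.real (cone p t₂) + μ.real (cone p m \ cone p t₂) :=
    (measureReal_mono (by rw [union_sdiff_self]; exact subset_union_right)).trans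
      (measureReal_union_le _ _)
  have hs₁ : μ.real (cone p t₁) ≤ μ.real (cone p m) + μ.real (cone p t₁ \ cone p m) :=
    (measureReal_mono (by rw [union_sdiff_self]; exact subset_union_right)).trans
      (measureReal_union_le _ _)
  refine ⟨?_, ?_, ?_⟩ <;> linarith

end Agreement

section Radius

variable {n : ℕ} {m : ℝ}

lemma sq_median_mem_Icc (hm0 : 0 ≤ m)
    (hm : (ProbabilityTheory.stdGaussian (EuclideanSpace ℝ (Fin n))).real {x | ‖x‖ ≤ m} = 1 / 2)
    (hq : (ProbabilityTheory.stdGaussian (EuclideanSpace ℝ (Fin n))).real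
      {x | (n : ℝ) / 2 ≤ |‖x‖ ^ 2 - n|} < 1 / 2) :
    m ^ 2 ∈ Icc ((n : ℝ) / 2) (3 / 2 * n) := by
  have hmc : (ProbabilityTheory.stdGaussian (EuclideanSpace ℝ (Fin n))).real {x | ‖x‖ ≤ m}ᶜ =
      1 / 2 := by
    rw [probReal_compl_eq_one_sub (measurableSet_le measurable_norm measurable_const), hm]
    norm_num
  constructor
  · by_contra! h
    refine hq.not_ge (hm ▸ measureReal_mono fun x (hx : ‖x‖ ≤ m) ↦ ?_)
    have := pow_le_pow_left₀ (norm_nonneg x) hx 2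
    have h' : (n : ℝ) / 2 ≤ |‖x‖ ^ 2 - n| := le_abs.2 (Or.inr (by linarith))
    exact h'
  · by_contra! h
    refine hq.not_ge (hmc ▸ measureReal_mono fun x (hx : ¬ ‖x‖ ≤ m) ↦ ?_)
    have := pow_le_pow_left₀ hm0 (not_le.1 hx).le 2
    have h' : (n : ℝ) / 2 ≤ |‖x‖ ^ 2 - n| := le_abs.2 (Or.inl (by linarith))
    exact h'

lemma median_mem_Icc (hn : 0 < n) (hm0 : 0 ≤ m) (hm2 : m ^ 2 ∈ Icc ((n : ℝ) / 2) (3 / 2 * n)) :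
    m ∈ Icc (1 / 2) (5 / 4 * √n) := by
  have h1 : (1 : ℝ) ≤ n := by exact_mod_cast hn
  have hs : √(n : ℝ) ^ 2 = n := sq_sqrt (by positivity)
  obtain ⟨h2, h3⟩ := hm2
  exact ⟨le_of_sq_le_sq (by linarith) hm0, le_of_sq_le_sq (by nlinarith) (by positivity)⟩

lemma quarter_le_tails (hn : 0 < n) (hm0 : 0 ≤ m)
    (hm : (ProbabilityTheory.stdGaussian (EuclideanSpace ℝ (Fin n))).real {x | ‖x‖ ≤ m} = 1 / 2)
    (hq : (ProbabilityTheory.stdGaussian (EuclideanSpace ℝ (Fin n))).real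
      {x | (n : ℝ) / 2 ≤ |‖x‖ ^ 2 - n|} ≤ 1 / 20) :
    1 / 4 ≤ (ProbabilityTheory.stdGaussian (EuclideanSpace ℝ (Fin n))).real
        {x | ‖x‖ ≤ m - 1 / 400} ∧
      1 / 4 ≤ (ProbabilityTheory.stdGaussian (EuclideanSpace ℝ (Fin n))).real
        {x | m + 1 / 400 ≤ ‖x‖} := by
  obtain ⟨hm1, hm2⟩ := median_mem_Icc hn hm0 (sq_median_mem_Icc hm0 hm (by linarith))
  have hmc : (ProbabilityTheory.stdGaussian (EuclideanSpace ℝ (Fin n))).real {x | ‖x‖ ≤ m}ᶜ =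
      1 / 2 := by
    rw [probReal_compl_eq_one_sub (measurableSet_le measurable_norm measurable_const), hm]
    norm_num
  have hsn : 0 < √(n : ℝ) := sqrt_pos.2 (by exact_mod_cast hn)
  have ha := sq_measure_annulus_le hn (a := m - 1 / 400) (b := m + 1 / 400)
    (by linarith) (by linarith)
  have hr : ((m + 1 / 400) ^ 2 - (m - 1 / 400) ^ 2) / √n ≤ 1 / 80 := by
    rw [div_le_iff₀ hsn]; nlinarith
  set μ := ProbabilityTheory.stdGaussian (EuclideanSpace ℝ (Fin n))
  set A : Set (EuclideanSpace ℝ (Fin n)) := {x | m - 1 / 400 < ‖x‖ ∧ ‖x‖ < m + 1 / 400}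
  have hA : μ.real A ≤ 1 / 4 :=
    le_of_sq_le_sq (by norm_num; linarith) (by norm_num)
  constructor
  · have hsub : {x : EuclideanSpace ℝ (Fin n) | ‖x‖ ≤ m} ⊆ {x | ‖x‖ ≤ m - 1 / 400} ∪ A :=
      fun x (hx : ‖x‖ ≤ m) ↦ (le_or_gt ‖x‖ (m - 1 / 400)).imp id fun h ↦ ⟨h, by linarith⟩
    have := (measureReal_mono hsub (μ := μ)).trans (measureReal_union_le _ _)
    linarith
  · have hsub : {x : EuclideanSpace ℝ (Fin n) | ‖x‖ ≤ m}ᶜ ⊆ {x | m + 1 / 400 ≤ ‖x‖} ∪ A :=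
      fun x hx ↦ (le_or_gt (m + 1 / 400) ‖x‖).imp id fun h ↦
        ⟨by linarith [not_le.1 (show ¬ ‖x‖ ≤ m from hx)], h⟩
    have := (measureReal_mono hsub (μ := μ)).trans (measureReal_union_le _ _)
    linarith

end Radius

lemma exists_agreement_of_seminorm :
    ∃ c : ℝ, 0 < c ∧ ∃ n₀ : ℕ, ∀ n : ℕ, n₀ ≤ n → c / √n ≤ 1 / 2 ∧
      ∀ p : Seminorm ℝ (EuclideanSpace ℝ (Fin n)), Continuous p → ∀ m : ℝ, 0 < m →
        (ProbabilityTheory.stdGaussian (EuclideanSpace ℝ (Fin n))).real {x | ‖x‖ ≤ m} = 1 / 2 →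
        1 / 2 + c / √n ≤ (ProbabilityTheory.stdGaussian (EuclideanSpace ℝ (Fin n))).real
          {x | ¬ p x < 1} ∨
        1 / 2 + c / √n ≤ (ProbabilityTheory.stdGaussian (EuclideanSpace ℝ (Fin n))).real
          {x | p x < 1} ∨
        1 / 2 + c / √n ≤ (ProbabilityTheory.stdGaussian (EuclideanSpace ℝ (Fin n))).real
          {x | ‖x‖ ≤ m ↔ p x < 1} := by
  obtain ⟨V, hV, hconc⟩ := exists_norm_sq_concentration
  refine ⟨1 / 10 ^ 8, by norm_num, ⌈(10 ^ 8 * V + 1) ^ 2⌉₊, fun n hn ↦ ?_⟩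
  have hn' : (10 ^ 8 * V + 1) ^ 2 ≤ (n : ℝ) := Nat.ceil_le.1 hn
  have hn0 : 0 < n := by
    have : (0 : ℝ) < n := lt_of_lt_of_le (by positivity) hn'
    exact_mod_cast this
  set s : ℝ := √n with hs
  have hss : s ^ 2 = n := sq_sqrt (by positivity)
  have hsV : 10 ^ 8 * V + 1 ≤ s := le_sqrt_of_sq_le hn'
  have hs1 : 1 ≤ s := by linarith
  have hs0 : 0 < s := by linarith
  set ε : ℝ := 1 / 10 ^ 8 / s with hε
  have hεs : ε * s = 1 / 10 ^ 8 := div_mul_cancel₀ _ hs0.ne'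
  have hε0 : 0 < ε := by positivity
  have hε1 : ε ≤ 1 / 10 ^ 8 := by nlinarith
  refine ⟨by linarith, fun p hp m hm0 hm ↦ ?_⟩
  by_contra hcon
  rw [not_or, not_or, not_le, not_le, not_le] at hcon
  obtain ⟨hU', hU, hball⟩ := hcon
  have : Nonempty (Fin n) := ⟨⟨0, hn0⟩⟩
  have : Nontrivial (EuclideanSpace ℝ (Fin n)) := inferInstance
  have hq := hconc n hn0
  have hVn : V / n ≤ ε := by
    rw [← hss, hε, div_le_div_iff₀ (by positivity) hs0]
    nlinarith
  have hq' := hq.trans hVn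
  obtain ⟨h₁, h₂⟩ := quarter_le_tails hn0 hm0.le hm (by linarith)
  obtain ⟨hm1, hm2⟩ := median_mem_Icc hn0 hm0.le (sq_median_mem_Icc hm0.le hm (by linarith))
  obtain ⟨hc, hc₂, hc₁⟩ := cone_bounds_of_agreement p hp hm h₁ h₂
    hU hU' hball
  have hN : 50 * s / (1 / 400) ≤ (⌈20000 * s⌉₊ : ℝ) :=
    (by linarith : _ ≤ 20000 * s).trans (Nat.le_ceil _)
  have hN' : (⌈20000 * s⌉₊ : ℝ) + 1 ≤ 30000 * s := by
    have := Nat.ceil_lt_add_one (show 0 ≤ 20000 * s by positivity)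
    linarith
  have hmain := cone_measure_le p hp hs0 (by norm_num : (0 : ℝ) < 1 / 400)
    (by linarith : 0 ≤ m - 1 / 400) (by linarith : _ ≤ m + 1 / 400) (by linarith) hN
  rw [hss] at hmain
  set μ := ProbabilityTheory.stdGaussian (EuclideanSpace ℝ (Fin n))
  have hl : (1 / 2 - 6 * ε) * (1 / 2 - 6 * ε) ≤
      μ.real (cone p (m + 1 / 400)) * (1 - μ.real (cone p (m - 1 / 400))) :=
    mul_le_mul hc₂ (by linarith) (by linarith) measureReal_nonneg
  have hr : ((⌈20000 * s⌉₊ : ℝ) + 1) * (μ.real (cone p (m - 1 / 400) \ cone p (m + 1 / 400)) +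
      μ.real {x | (n : ℝ) / 2 ≤ |‖x‖ ^ 2 - n|}) ≤ 30000 * s * (4 * ε + ε) := by
    gcongr
  have hr' : 30000 * s * (4 * ε + ε) = 150000 * (ε * s) := by ring
  rw [hr', hεs] at hr
  nlinarith

lemma zero_mem_interior_of_symmetric {E : Type*} [NormedAddCommGroup E] [NormedSpace ℝ E]
    {K : Set E} (hK : Convex ℝ K) (hsymm : ∀ x, x ∈ K ↔ -x ∈ K) (hne : (interior K).Nonempty) :
    0 ∈ interior K := by
  obtain ⟨x, hx⟩ := hne
  have hK' : Homeomorph.neg E ⁻¹' K = K := by ext y; exact (hsymm y).symm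
  have hx' : -x ∈ interior K := by
    rw [← hK', ← (Homeomorph.neg E).preimage_interior]
    simpa using hx
  have := hK.interior hx hx' (by norm_num : (0 : ℝ) ≤ 1 / 2) (by norm_num : (0 : ℝ) ≤ 1 / 2)
    (by norm_num)
  simpa using this

lemma exists_seminorm_of_zero_mem_interior {E : Type*} [NormedAddCommGroup E] [NormedSpace ℝ E]
    {K : Set E} (hK : Convex ℝ K) (hsymm : ∀ x, x ∈ K ↔ -x ∈ K) (h0 : 0 ∈ interior K) :
    ∃ p : Seminorm ℝ E, Continuous p ∧ ∀ x, p x < 1 ↔ x ∈ interior K := by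
  have hnhds : K ∈ nhds (0 : E) := mem_interior_iff_mem_nhds.1 h0
  have hbal : Balanced ℝ K := (balanced_iff_neg_mem hK).2 fun x ↦ (hsymm x).1
  exact ⟨gaugeSeminorm hbal hK (absorbent_nhds_zero hnhds), continuous_gauge hK hnhds,
    fun x ↦ gauge_lt_one_iff_mem_interior hK hnhds⟩

lemma stdGaussian_eq_stdGaussian (n : ℕ) :
    _root_.stdGaussian n = ProbabilityTheory.stdGaussian (EuclideanSpace ℝ (Fin n)) := by
  rw [← map_pi_eq_stdGaussian]
  rfl

end GaussianConvex

/-- Weak learning centrally symmetric convex sets: one of the three hypotheses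
(empty set, all of `ℝⁿ`, origin-centered ball of radius `r_median`) agrees with `K`
with probability at least `1/2 + c/√n` under the standard Gaussian. -/
theorem weak_learn_centrally_symmetric :
    ∃ c : ℝ, 0 < c ∧ ∃ n₀ : ℕ, ∀ n : ℕ, n₀ ≤ n →
      ∀ K : Set (EuclideanSpace ℝ (Fin n)),
        Convex ℝ K → (∀ x, x ∈ K ↔ -x ∈ K) →
        ∀ rmedian : ℝ, 0 < rmedian →
          stdGaussian n (Metric.closedBall (0 : EuclideanSpace ℝ (Fin n)) rmedian)
            = 1 / 2 →
        (1 / 2 + c / Real.sqrt n ≤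
            (stdGaussian n {x | (-1 : ℝ) = pmInd K x}).toReal) ∨
        (1 / 2 + c / Real.sqrt n ≤
            (stdGaussian n {x | (1 : ℝ) = pmInd K x}).toReal) ∨
        (1 / 2 + c / Real.sqrt n ≤
            (stdGaussian n
              {x | (if ‖x‖ ≤ rmedian then (1 : ℝ) else -1) = pmInd K x}).toReal) := by
  obtain ⟨c, hc, n₀, h⟩ := GaussianConvex.exists_agreement_of_seminorm
  refine ⟨c, hc, n₀, fun n hn K hK hsymm m hm0 hm ↦ ?_⟩
  obtain ⟨hcn, h⟩ := h n hn
  rw [GaussianConvex.stdGaussian_eq_stdGaussian] at hm ⊢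
  set μ := ProbabilityTheory.stdGaussian (EuclideanSpace ℝ (Fin n)) with hμ
  have e₁ : {x | (-1 : ℝ) = pmInd K x} = {x | x ∉ K} := by
    ext x; by_cases hx : x ∈ K <;> simp [pmInd, hx]; norm_num
  have e₂ : {x | (1 : ℝ) = pmInd K x} = {x | x ∈ K} := by
    ext x; by_cases hx : x ∈ K <;> simp [pmInd, hx]; norm_num
  have e₃ : {x | (if ‖x‖ ≤ m then (1 : ℝ) else -1) = pmInd K x} = {x | ‖x‖ ≤ m ↔ x ∈ K} := by
    ext x
    by_cases hx : x ∈ K <;> by_cases hx' : ‖x‖ ≤ m <;> simp [pmInd, hx, hx'] <;> norm_num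
  rw [e₁, e₂, e₃]
  have hfr : ∀ᵐ x ∂μ, x ∉ frontier K :=
    (GaussianConvex.stdGaussian_absolutelyContinuous _).ae_le (measure_eq_zero_iff_ae_notMem.1
      (hK.addHaar_frontier volume))
  have hint : ∀ᵐ x ∂μ, (x ∈ K ↔ x ∈ interior K) := by
    filter_upwards [hfr] with x hx
    refine ⟨fun h ↦ ?_, fun h ↦ interior_subset h⟩
    by_contra hi
    exact hx ⟨subset_closure h, hi⟩
  by_cases hne : (interior K).Nonempty
  · obtain ⟨p, hp, hpK⟩ := GaussianConvex.exists_seminorm_of_zero_mem_interior hK hsymm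
      (GaussianConvex.zero_mem_interior_of_symmetric hK hsymm hne)
    have hpae : ∀ᵐ x ∂μ, (x ∈ K) = (p x < 1) := by
      filter_upwards [hint] with x hx
      rw [hx, hpK]
    have c₁ : μ {x | x ∉ K} = μ {x | ¬ p x < 1} := measure_congr (by
      filter_upwards [hpae] with x hx
      exact congrArg Not hx)
    have c₂ : μ {x | x ∈ K} = μ {x | p x < 1} := measure_congr hpae
    have c₃ : μ {x | ‖x‖ ≤ m ↔ x ∈ K} = μ {x | ‖x‖ ≤ m ↔ p x < 1} := measure_congr (by
      filter_upwards [hpae] with x hx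
      exact congrArg (‖x‖ ≤ m ↔ ·) hx)
    rw [c₁, c₂, c₃]
    refine h p hp m hm0 ?_
    have : {x : EuclideanSpace ℝ (Fin n) | ‖x‖ ≤ m} = Metric.closedBall 0 m := by ext; simp
    rw [this, measureReal_def, hm]
    simp
  · refine Or.inl ?_
    have hempty := Set.not_nonempty_iff_eq_empty.1 hne
    have : μ {x | x ∉ K} = 1 := by
      rw [← measure_univ (μ := μ)]
      refine measure_congr ?_
      filter_upwards [hint] with x hx
      rw [hempty] at hx
      exact eq_true (p := x ∉ K) fun h ↦ hx.1 h
    rw [this, ENNReal.toReal_one]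
    linarith
end

section
/- There exist an absolute constant c > 0 and n₀ ∈ ℕ such that for all n ≥ n₀ and every centrally symmetric convex set K ⊆ ℝⁿ (viewed as a ±1-valued function), the combined Hermite weight of K at levels 0 and 2 satisfies W^{=0}[K] + W^{=2}[K] ≥ c/n. -/
open MeasureTheory ProbabilityTheory

/-- The normalized probabilists' Hermite polynomial `h_d(x) = He_d(x)/√(d!)`,
orthonormal with respect to `N(0,1)`. -/
noncomputable def normHermite (d : ℕ) (x : ℝ) : ℝ :=
  (Polynomial.aeval x (Polynomial.hermite d)) / Real.sqrt (Nat.factorial d)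

/-- The Hermite coefficient `f̃(S) = E_{g ∼ N(0,1)ⁿ}[f(g) · ∏ᵢ h_{Sᵢ}(gᵢ)]`. -/
noncomputable def hermiteCoeff (n : ℕ) (f : EuclideanSpace ℝ (Fin n) → ℝ)
    (S : Fin n → ℕ) : ℝ :=
  ∫ x, f x * ∏ i, normHermite (S i) (x i) ∂(stdGaussian n)

/-- The Hermite weight of `f` at level `j`: `W^{=j}[f] = Σ_{|S| = j} f̃(S)²`. -/
noncomputable def hermiteWeight (n : ℕ) (f : EuclideanSpace ℝ (Fin n) → ℝ)
    (j : ℕ) : ℝ :=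
  ∑' S : {S : Fin n → ℕ // ∑ i, S i = j}, (hermiteCoeff n f S.1) ^ 2

section StandardGaussian

open scoped Pointwise

variable {E : Type*} [NormedAddCommGroup E] [InnerProductSpace ℝ E] [FiniteDimensional ℝ E]
  [MeasurableSpace E] [BorelSpace E]

variable (E) in
/-- The density of the standard Gaussian measure on a Euclidean space. -/
noncomputable def stdGaussianDensity (x : E) : ℝ :=
  ((2 * Real.pi) ^ ((Module.finrank ℝ E : ℝ) / 2))⁻¹ * Real.exp (-(1 / 2) * ‖x‖ ^ 2)

omit [FiniteDimensional ℝ E] [MeasurableSpace E] [BorelSpace E] in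
lemma stdGaussianDensity_nonneg (x : E) : 0 ≤ stdGaussianDensity E x := by
  unfold stdGaussianDensity
  positivity

omit [FiniteDimensional ℝ E] in
lemma measurable_stdGaussianDensity : Measurable (stdGaussianDensity E) := by
  unfold stdGaussianDensity
  fun_prop

lemma integral_stdGaussianDensity : ∫ x, stdGaussianDensity E x = 1 := by
  unfold stdGaussianDensity
  rw [integral_const_mul, GaussianFourier.integral_rexp_neg_mul_sq_norm (by norm_num)]
  rw [show Real.pi / (1 / 2) = 2 * Real.pi by ring]
  exact inv_mul_cancel₀ (by positivity)

lemma integrable_stdGaussianDensity : Integrable (stdGaussianDensity E) :=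
  Integrable.of_integral_ne_zero (by rw [integral_stdGaussianDensity]; exact one_ne_zero)

lemma stdGaussian_eq_withDensity :
    ProbabilityTheory.stdGaussian E =
      volume.withDensity fun x => ENNReal.ofReal (stdGaussianDensity E x) := by
  have : IsFiniteMeasure
      (volume.withDensity fun x => ENNReal.ofReal (stdGaussianDensity E x)) :=
    isFiniteMeasure_withDensity_ofReal integrable_stdGaussianDensity.2
  refine Measure.ext_of_charFun (funext fun t => ?_)
  rw [charFun_stdGaussian, charFun_apply,
    integral_withDensity_eq_integral_toReal_smul
      measurable_stdGaussianDensity.ennreal_ofReal (by simp)]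
  have h := GaussianFourier.integral_cexp_neg_mul_sq_norm_add (b := (1 / 2 : ℂ)) (V := E)
    (by norm_num) Complex.I t
  have h2 : ∀ v : E, (ENNReal.ofReal (stdGaussianDensity E v)).toReal •
      Complex.exp ((inner ℝ v t : ℝ) * Complex.I) =
      (((2 * Real.pi) ^ ((Module.finrank ℝ E : ℝ) / 2))⁻¹ : ℝ) *
        Complex.exp (-(1 / 2 : ℂ) * ‖v‖ ^ 2 + Complex.I * (inner ℝ t v : ℝ)) := by
    intro v
    rw [ENNReal.toReal_ofReal (stdGaussianDensity_nonneg v), stdGaussianDensity, Complex.exp_add,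
      real_inner_comm, Complex.real_smul]
    push_cast
    rw [mul_comm Complex.I]
    ring
  simp_rw [h2]
  rw [integral_const_mul, h, ← mul_assoc]
  have h3 : (((2 * Real.pi) ^ ((Module.finrank ℝ E : ℝ) / 2))⁻¹ : ℝ) *
      ((Real.pi : ℂ) / (1 / 2)) ^ ((Module.finrank ℝ E : ℂ) / 2) = 1 := by
    rw [show (Real.pi : ℂ) / (1 / 2) = ((2 * Real.pi : ℝ) : ℂ) by push_cast; ring,
      show ((Module.finrank ℝ E : ℂ) / 2) = (((Module.finrank ℝ E : ℝ) / 2 : ℝ) : ℂ) by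
        push_cast; ring, ← Complex.ofReal_cpow (by positivity), ← Complex.ofReal_mul,
      inv_mul_cancel₀ (by positivity), Complex.ofReal_one]
  rw [h3, Complex.I_sq]
  ring_nf

lemma stdGaussian_absolutelyContinuous : ProbabilityTheory.stdGaussian E ≪ volume := by
  rw [stdGaussian_eq_withDensity]
  exact withDensity_absolutelyContinuous _ _

lemma setIntegral_stdGaussian {s : Set E} (hs : MeasurableSet s) (g : E → ℝ) :
    ∫ x in s, g x ∂(ProbabilityTheory.stdGaussian E) =
      ∫ x in s, stdGaussianDensity E x * g x := by
  rw [stdGaussian_eq_withDensity, setIntegral_withDensity_eq_setIntegral_toReal_smul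
    measurable_stdGaussianDensity.ennreal_ofReal (by simp) _ hs]
  simp [ENNReal.toReal_ofReal (stdGaussianDensity_nonneg _)]

lemma integrable_norm_pow_stdGaussian (k : ℕ) :
    Integrable (fun x => ‖x‖ ^ k) (ProbabilityTheory.stdGaussian E) := by
  have := (IsGaussian.memLp_id (ProbabilityTheory.stdGaussian E) (k : ENNReal)
    (by simp)).integrable_norm_pow'
  simpa using this

lemma integrable_finrank_sub_norm_sq_stdGaussian :
    Integrable (fun x => (Module.finrank ℝ E : ℝ) - ‖x‖ ^ 2)
      (ProbabilityTheory.stdGaussian E) :=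
  (integrable_const _).sub (integrable_norm_pow_stdGaussian 2)

lemma integrable_finrank_sub_norm_sq_sq_stdGaussian :
    Integrable (fun x => ((Module.finrank ℝ E : ℝ) - ‖x‖ ^ 2) ^ 2)
      (ProbabilityTheory.stdGaussian E) := by
  have h : Integrable (fun x => (Module.finrank ℝ E : ℝ) ^ 2
      - 2 * (Module.finrank ℝ E : ℝ) * ‖x‖ ^ 2 + ‖x‖ ^ 4) (ProbabilityTheory.stdGaussian E) :=
    ((integrable_const _).sub ((integrable_norm_pow_stdGaussian 2).const_mul _)).add
      (integrable_norm_pow_stdGaussian 4)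
  refine h.congr (ae_of_all _ fun x => ?_)
  ring

/-- The Gaussian measure of a dilate is controlled by an exponential moment. -/
lemma measureReal_exp_smul_le {s : ℝ} (hs : 0 ≤ s) {K : Set E} (hK : MeasurableSet K) :
    (ProbabilityTheory.stdGaussian E).real (Real.exp s • K) ≤
      ∫ x in K, Real.exp (s * ((Module.finrank ℝ E : ℝ) - ‖x‖ ^ 2))
        ∂(ProbabilityTheory.stdGaussian E) := by
  have hR : Real.exp s ≠ 0 := (Real.exp_pos s).ne'
  have hKs : MeasurableSet (Real.exp s • K) := hK.const_smul₀ _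
  have h1 : (ProbabilityTheory.stdGaussian E).real (Real.exp s • K) =
      ∫ x in Real.exp s • K, stdGaussianDensity E x := by
    have := setIntegral_stdGaussian hKs (fun _ : E => (1 : ℝ))
    simpa using this
  have h2 := Measure.setIntegral_comp_smul volume (stdGaussianDensity E) K hR
  rw [abs_of_pos (by positivity), smul_eq_mul] at h2
  have h3 : ∫ x in Real.exp s • K, stdGaussianDensity E x =
      ∫ x in K, Real.exp s ^ Module.finrank ℝ E * stdGaussianDensity E (Real.exp s • x) := by
    rw [integral_const_mul, h2, ← mul_assoc, mul_inv_cancel₀ (by positivity), one_mul]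
  rw [h1, h3, setIntegral_stdGaussian hK]
  have hle : ∀ x : E, Real.exp (s * ((Module.finrank ℝ E : ℝ) - ‖x‖ ^ 2)) ≤
      Real.exp (s * (Module.finrank ℝ E : ℝ)) := fun x =>
    Real.exp_le_exp.2 (mul_le_mul_of_nonneg_left (by linarith [sq_nonneg ‖x‖]) hs)
  refine setIntegral_mono_on ?_ ?_ hK fun x _ => ?_
  · exact ((integrable_stdGaussianDensity.comp_smul hR).const_mul _).integrableOn
  · refine Integrable.integrableOn (integrable_stdGaussianDensity.mul_bdd
      (c := Real.exp (s * (Module.finrank ℝ E : ℝ))) ?_ ?_)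
    · exact (Continuous.aestronglyMeasurable (by fun_prop))
    · exact ae_of_all _ fun x => by
        rw [Real.norm_eq_abs, abs_of_pos (Real.exp_pos _)]
        exact hle x
  · have h4 : Real.exp s ^ 2 ≥ 1 + 2 * s := by
      rw [← Real.exp_nat_mul]
      have := Real.add_one_le_exp (((2 : ℕ) : ℝ) * s)
      push_cast at *
      linarith
    unfold stdGaussianDensity
    rw [norm_smul, Real.norm_eq_abs, abs_of_pos (Real.exp_pos s), ← Real.exp_nat_mul,
      mul_left_comm, mul_assoc, ← Real.exp_add, ← Real.exp_add]
    refine mul_le_mul_of_nonneg_left (Real.exp_le_exp.2 ?_) (by positivity)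
    nlinarith [mul_le_mul_of_nonneg_right h4 (sq_nonneg ‖x‖)]

lemma exp_le_one_add_add_sq {z : ℝ} (hz : z ≤ 1) : Real.exp z ≤ 1 + z + z ^ 2 := by
  by_cases h : -1 ≤ z
  · have := (abs_le.1 (Real.abs_exp_sub_one_sub_id_le (abs_le.2 ⟨h, hz⟩))).2
    linarith
  · push Not at h
    have : Real.exp z ≤ 1 := Real.exp_le_one_iff.2 (by linarith)
    nlinarith

/-- Second-order upper bound for the Gaussian measure of the dilates of a set. -/
lemma exists_measureReal_exp_smul_sub_le {K : Set E} (hK : MeasurableSet K) :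
    ∃ C : ℝ, 0 ≤ C ∧ ∀ s : ℝ, 0 ≤ s →
      (ProbabilityTheory.stdGaussian E).real (Real.exp s • K) -
        (ProbabilityTheory.stdGaussian E).real K ≤
      s * (∫ x in K, ((Module.finrank ℝ E : ℝ) - ‖x‖ ^ 2) ∂(ProbabilityTheory.stdGaussian E))
        + C * s ^ 2 := by
  set γ := ProbabilityTheory.stdGaussian E
  set n : ℝ := (Module.finrank ℝ E : ℝ)
  set D : ℝ := ∫ x in K, (n - ‖x‖ ^ 2) ∂γ
  set M : ℝ := ∫ x in K, (n - ‖x‖ ^ 2) ^ 2 ∂γ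
  have hn : 0 ≤ n := Nat.cast_nonneg _
  have hM : 0 ≤ M := integral_nonneg fun x => sq_nonneg _
  refine ⟨M + n ^ 2 + n * |D|, by positivity, fun s hs => ?_⟩
  by_cases hsn : s * n ≤ 1
  · have hi1 : IntegrableOn (fun x : E => s * (n - ‖x‖ ^ 2)) K γ :=
      (integrable_finrank_sub_norm_sq_stdGaussian.const_mul s).integrableOn
    have hi2 : IntegrableOn (fun x : E => s ^ 2 * (n - ‖x‖ ^ 2) ^ 2) K γ :=
      (integrable_finrank_sub_norm_sq_sq_stdGaussian.const_mul _).integrableOn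
    have hi0 : IntegrableOn (fun _ : E => (1 : ℝ)) K γ := (integrable_const _).integrableOn
    have hi01 : IntegrableOn (fun x : E => 1 + s * (n - ‖x‖ ^ 2)) K γ := hi0.add hi1
    have hpt : ∀ x : E, Real.exp (s * (n - ‖x‖ ^ 2)) ≤
        1 + s * (n - ‖x‖ ^ 2) + s ^ 2 * (n - ‖x‖ ^ 2) ^ 2 := fun x => by
      have h1 : s * (n - ‖x‖ ^ 2) ≤ 1 := by nlinarith [mul_nonneg hs (sq_nonneg ‖x‖)]
      have h2 := exp_le_one_add_add_sq h1
      linarith [mul_pow s (n - ‖x‖ ^ 2) 2]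
    have h : (γ.real (Real.exp s • K)) ≤
        ∫ x in K, (1 + s * (n - ‖x‖ ^ 2) + s ^ 2 * (n - ‖x‖ ^ 2) ^ 2) ∂γ := by
      refine (measureReal_exp_smul_le hs hK).trans (integral_mono_of_nonneg
        (ae_of_all _ fun x => (Real.exp_pos _).le) (hi01.add hi2)
        (ae_of_all _ hpt))
    rw [integral_add hi01 hi2, integral_add hi0 hi1, integral_const_mul,
      integral_const_mul] at h
    simp only [integral_const, MeasurableSet.univ, measureReal_restrict_apply, Set.univ_inter,
      smul_eq_mul, mul_one] at h
    change _ ≤ _ + s * D + s ^ 2 * M at h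
    nlinarith [mul_nonneg (add_nonneg (sq_nonneg n) (mul_nonneg hn (abs_nonneg D))) (sq_nonneg s)]
  · push Not at hsn
    have h1 : γ.real (Real.exp s • K) ≤ 1 := measureReal_le_one
    have h2 : 0 ≤ γ.real K := measureReal_nonneg
    have h3 : 1 ≤ (s * n) ^ 2 := one_le_pow₀ hsn.le
    have h4 : s * |D| ≤ s * |D| * (s * n) :=
      le_mul_of_one_le_right (by positivity) hsn.le
    have h5 : -(s * |D|) ≤ s * D := by nlinarith [neg_abs_le D]
    nlinarith [mul_nonneg hM (sq_nonneg s)]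

lemma integral_id_stdGaussian_eq_zero :
    ∫ x : E, id x ∂(ProbabilityTheory.stdGaussian E) = 0 :=
  integral_id_stdGaussian

/-- Two points at angular distance `δ` on a Gaussian great circle have the same joint law as the
initial pair. -/
lemma measure_crossing_rotation {K : Set E} (hK : MeasurableSet K) (θ δ : ℝ) :
    ((ProbabilityTheory.stdGaussian E).prod (ProbabilityTheory.stdGaussian E))
      {p | Real.cos θ • p.1 + Real.sin θ • p.2 ∉ K ∧
        Real.cos (θ + δ) • p.1 + Real.sin (θ + δ) • p.2 ∈ K} =
    ((ProbabilityTheory.stdGaussian E).prod (ProbabilityTheory.stdGaussian E))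
      {p | p.1 ∉ K ∧ Real.cos δ • p.1 + Real.sin δ • p.2 ∈ K} := by
  have hm : MeasurableSet {p : E × E | p.1 ∉ K ∧ Real.cos δ • p.1 + Real.sin δ • p.2 ∈ K} :=
    (measurable_fst hK.compl).inter
      ((by fun_prop : Measurable fun p : E × E => Real.cos δ • p.1 + Real.sin δ • p.2) hK)
  conv_rhs => rw [← IsGaussian.map_rotation_eq_self
    (μ := ProbabilityTheory.stdGaussian E) integral_id_stdGaussian_eq_zero θ]
  rw [Measure.map_apply (by fun_prop) hm]
  congr 1
  ext p
  simp only [Set.mem_ofPred_eq, Set.mem_preimage, ContinuousLinearMap.rotation_apply]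
  have : Real.cos (θ + δ) • p.1 + Real.sin (θ + δ) • p.2 =
      Real.cos δ • (Real.cos θ • p.1 + Real.sin θ • p.2) +
        Real.sin δ • (-Real.sin θ • p.1 + Real.cos θ • p.2) := by
    rw [Real.cos_add, Real.sin_add]
    module
  rw [this]

/-- Discretised Maurey–Pisier argument: moving from `x ∉ K` to `y ∈ K` along a quarter circle in
`N` equal steps, one of the steps has to enter `K`. -/
lemma measureReal_mul_compl_le_crossing {K : Set E} (hK : MeasurableSet K) {N : ℕ} (hN : 0 < N) :
    (ProbabilityTheory.stdGaussian E).real Kᶜ * (ProbabilityTheory.stdGaussian E).real K ≤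
      N * ((ProbabilityTheory.stdGaussian E).prod (ProbabilityTheory.stdGaussian E)).real
        {p | p.1 ∉ K ∧ Real.cos (Real.pi / (2 * N)) • p.1 +
          Real.sin (Real.pi / (2 * N)) • p.2 ∈ K} := by
  set γ := ProbabilityTheory.stdGaussian E
  set δ : ℝ := Real.pi / (2 * N)
  let A : ℕ → Set (E × E) := fun k =>
    {p | Real.cos (k * δ) • p.1 + Real.sin (k * δ) • p.2 ∉ K ∧
        Real.cos (k * δ + δ) • p.1 + Real.sin (k * δ + δ) • p.2 ∈ K}
  have hsub : Kᶜ ×ˢ K ⊆ ⋃ k ∈ Finset.range N, A k := by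
    rintro ⟨x, y⟩ ⟨hx, hy⟩
    by_contra hcon
    simp only [Set.mem_iUnion, not_exists, Finset.mem_range] at hcon
    have hind : ∀ k : ℕ, k ≤ N → Real.cos (k * δ) • x + Real.sin (k * δ) • y ∉ K := by
      intro k
      induction k with
      | zero => intro _; simpa using hx
      | succ k ih =>
        intro hk hmem
        refine hcon k hk ⟨ih (by omega), ?_⟩
        simpa [add_mul] using hmem
    refine hind N le_rfl ?_
    have : (N : ℝ) * δ = Real.pi / 2 := by
      have : (N : ℝ) ≠ 0 := by positivity
      simp only [δ]
      field_simp
    simpa [this] using hy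
  rw [← measureReal_prod_prod]
  calc (γ.prod γ).real (Kᶜ ×ˢ K) ≤ (γ.prod γ).real (⋃ k ∈ Finset.range N, A k) :=
        measureReal_mono hsub (measure_ne_top _ _)
    _ ≤ ∑ k ∈ Finset.range N, (γ.prod γ).real (A k) := measureReal_biUnion_finset_le _ _
    _ = _ := by
        have : ∀ k ∈ Finset.range N, (γ.prod γ).real (A k) = (γ.prod γ).real
            {p | p.1 ∉ K ∧ Real.cos δ • p.1 + Real.sin δ • p.2 ∈ K} := fun k _ => by
          simp only [measureReal_def]
          rw [measure_crossing_rotation hK]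
        rw [Finset.sum_congr rfl this]
        simp

lemma map_stdGaussian_of_norm_eq_one {f : StrongDual ℝ E} (hf : ‖f‖ = 1) :
    (ProbabilityTheory.stdGaussian E).map f = gaussianReal 0 1 := by
  rw [IsGaussian.map_eq_gaussianReal, integral_strongDual_stdGaussian, variance_dual_stdGaussian,
    hf]
  simp

omit [FiniteDimensional ℝ E] [MeasurableSpace E] [BorelSpace E] in
/-- A unit linear functional strictly separating a point from an open symmetric convex set. -/
lemma exists_norm_one_forall_abs_lt {K : Set E} (hc : Convex ℝ K) (ho : IsOpen K)
    (hs : ∀ x ∈ K, -x ∈ K) (h0 : (0 : E) ∈ K) {x : E} (hx : x ∉ K) :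
    ∃ f : StrongDual ℝ E, ‖f‖ = 1 ∧ ∀ a ∈ K, |f a| < f x := by
  obtain ⟨f, hf⟩ := geometric_hahn_banach_open_point hc ho hx
  have hfx : 0 < f x := by simpa using hf 0 h0
  have hf0 : 0 < ‖f‖ := norm_pos_iff.2 fun h => by simp [h] at hfx
  refine ⟨‖f‖⁻¹ • f, by rw [norm_smul, norm_inv, norm_norm, inv_mul_cancel₀ hf0.ne'],
    fun a ha => ?_⟩
  have h1 := hf a ha
  have h2 := hf (-a) (hs a ha)
  rw [map_neg] at h2
  simp only [_root_.smul_apply, smul_eq_mul, abs_mul, abs_inv, abs_norm]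
  exact mul_lt_mul_of_pos_left (abs_lt.2 ⟨by linarith, h1⟩) (inv_pos.2 hf0)

lemma gaussianReal_real_abs_lt_le {r : ℝ} (hr : 0 ≤ r) :
    (gaussianReal 0 1).real {g | |g| < r} ≤ r := by
  rw [measureReal_def, gaussianReal_apply_eq_integral 0 one_ne_zero,
    ENNReal.toReal_ofReal (integral_nonneg fun x => gaussianPDFReal_nonneg _ _ _)]
  have hset : {g : ℝ | |g| < r} = Set.Ioo (-r) r := by
    ext g
    simp [abs_lt]
  rw [hset]
  have hb : ∀ x, gaussianPDFReal 0 1 x ≤ 1 / 2 := fun x => by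
    rw [gaussianPDFReal_def]
    have h1 : (2 : ℝ) ≤ √(2 * Real.pi * (1 : NNReal)) := by
      rw [NNReal.coe_one, mul_one]
      refine Real.le_sqrt_of_sq_le ?_
      nlinarith [Real.pi_gt_three]
    have h2 : Real.exp (-(x - 0) ^ 2 / (2 * (1 : NNReal))) ≤ 1 := by
      refine Real.exp_le_one_iff.2 ?_
      rw [NNReal.coe_one]
      nlinarith [sq_nonneg (x - 0)]
    calc _ ≤ (√(2 * Real.pi * (1 : NNReal)))⁻¹ * 1 :=
        mul_le_mul_of_nonneg_left h2 (by positivity)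
      _ ≤ 1 / 2 := by
        rw [mul_one, one_div]
        exact inv_anti₀ two_pos h1
  calc ∫ x in Set.Ioo (-r) r, gaussianPDFReal 0 1 x
      ≤ ∫ _ in Set.Ioo (-r) r, (1 / 2 : ℝ) :=
        setIntegral_mono_on (integrable_gaussianPDFReal 0 1).integrableOn
          (integrableOn_const (by simp)) measurableSet_Ioo fun x _ => hb x
    _ = r := by
        simp [measureReal_def, Real.volume_Ioo]
        rw [ENNReal.toReal_ofReal (by linarith)]
        ring

/-- An open symmetric convex set of large Gaussian measure contains a closed ball. -/
lemma closedBall_subset_of_lt_measureReal {K : Set E} (hc : Convex ℝ K) (ho : IsOpen K)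
    (hs : ∀ x ∈ K, -x ∈ K) (h0 : (0 : E) ∈ K) {r : ℝ}
    (hr : r < (ProbabilityTheory.stdGaussian E).real K) : Metric.closedBall (0 : E) r ⊆ K := by
  intro x hx
  by_contra hxK
  obtain ⟨f, hf1, hf⟩ := exists_norm_one_forall_abs_lt hc ho hs h0 hxK
  have hx' : ‖x‖ ≤ r := by simpa using hx
  have hfx : f x ≤ r := by
    have := (le_abs_self _).trans (f.le_opNorm x)
    rw [hf1, one_mul] at this
    linarith
  have h1 : (ProbabilityTheory.stdGaussian E).real K ≤
      (ProbabilityTheory.stdGaussian E).real (f ⁻¹' {g | |g| < r}) :=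
    measureReal_mono fun a ha => (hf a ha).trans_le hfx
  have h2 : (ProbabilityTheory.stdGaussian E).real (f ⁻¹' {g | |g| < r}) ≤ r := by
    rw [← map_measureReal_apply (by fun_prop)
      (measurableSet_lt (by fun_prop) measurable_const), map_stdGaussian_of_norm_eq_one hf1]
    exact gaussianReal_real_abs_lt_le ((norm_nonneg x).trans hx')
  linarith

omit [FiniteDimensional ℝ E] [MeasurableSpace E] [BorelSpace E] in
/-- If a combination of `x ∉ K` and `y` enters `K`, then the gauge of `x` is controlled by a
one-dimensional projection of `y` that depends on `x` only. -/
lemma exists_norm_one_mul_gauge_le {K : Set E} (hc : Convex ℝ K) (ho : IsOpen K)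
    (hs : ∀ x ∈ K, -x ∈ K) {r : ℝ} (hr : 0 < r) (hb : Metric.closedBall (0 : E) r ⊆ K)
    {x : E} (hx : x ∉ K) :
    ∃ f : StrongDual ℝ E, ‖f‖ = 1 ∧ ∀ c s : ℝ, 0 ≤ s → ∀ y : E, c • x + s • y ∈ K →
      c * gauge K x ≤ 1 + s * |f y| / r := by
  have h0 : (0 : E) ∈ K := hb (Metric.mem_closedBall_self hr.le)
  have habs : Absorbent ℝ K := absorbent_nhds_zero (ho.mem_nhds h0)
  set τ := gauge K x
  have hτ : 1 ≤ τ := one_le_gauge_of_notMem (hc.starConvex h0) (habs x) hx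
  have hτ0 : 0 < τ := one_pos.trans_le hτ
  have hx' : τ⁻¹ • x ∉ K := fun h => by
    have h1 := gauge_lt_one_of_mem_of_isOpen ho h
    rw [gauge_smul_of_nonneg (inv_nonneg.2 hτ0.le), smul_eq_mul, inv_mul_cancel₀ hτ0.ne'] at h1
    exact lt_irrefl _ h1
  obtain ⟨f, hf1, hf⟩ := exists_norm_one_forall_abs_lt hc ho hs h0 hx'
  rw [map_smul, smul_eq_mul] at hf
  set h : ℝ := τ⁻¹ * f x
  have hfx : f x = τ * h := by simp only [h]; field_simp
  have hrh : r ≤ h := by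
    have := ContinuousLinearMap.opNorm_bound_of_ball_bound hr h f
      fun z hz => (hf z (hb hz)).le
    rw [hf1, le_div_iff₀ hr, one_mul] at this
    exact this
  refine ⟨f, hf1, fun c s hs0 y hy => ?_⟩
  have h1 := (le_abs_self _).trans_lt (hf _ hy)
  rw [map_add, map_smul, map_smul, smul_eq_mul, smul_eq_mul, hfx] at h1
  have hh : 0 < h := hr.trans_le hrh
  have h2 : s * -|f y| ≤ s * f y := mul_le_mul_of_nonneg_left (neg_abs_le _) hs0
  have h3 : s * |f y| / h ≤ s * |f y| / r :=
    div_le_div_of_nonneg_left (by positivity) hr hrh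
  have h4 : c * τ ≤ 1 + s * |f y| / h := by
    rw [← sub_le_iff_le_add', le_div_iff₀ hh]
    nlinarith
  linarith

lemma one_lt_exp_sq_mul_cos {δ : ℝ} (h0 : 0 < δ) (h1 : δ < 1) :
    1 < Real.exp (δ ^ 2) * Real.cos δ := by
  have h2 := Real.one_sub_sq_div_two_le_cos (x := δ)
  have h3 := Real.add_one_le_exp (δ ^ 2)
  have h4 : δ ^ 2 < 1 := by nlinarith
  have h5 : 0 < δ ^ 2 := by positivity
  calc 1 < (δ ^ 2 + 1) * (1 - δ ^ 2 / 2) := by nlinarith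
    _ ≤ Real.exp (δ ^ 2) * Real.cos δ :=
      mul_le_mul h3 h2 (by nlinarith) (Real.exp_pos _).le

omit [FiniteDimensional ℝ E] [MeasurableSpace E] [BorelSpace E] in
lemma exists_norm_one_gauge_lt_exp {K : Set E} (hc : Convex ℝ K) (ho : IsOpen K)
    (hs : ∀ x ∈ K, -x ∈ K) {r : ℝ} (hr : 0 < r) (hb : Metric.closedBall (0 : E) r ⊆ K)
    {δ : ℝ} (hδ0 : 0 < δ) (hδ1 : δ < 1) {x : E} (hx : x ∉ K) :
    ∃ f : StrongDual ℝ E, ‖f‖ = 1 ∧ ∀ y : E, Real.cos δ • x + Real.sin δ • y ∈ K →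
      gauge K x < Real.exp (δ * |f y| / r + δ ^ 2) := by
  obtain ⟨f, hf1, hf⟩ := exists_norm_one_mul_gauge_le hc ho hs hr hb hx
  refine ⟨f, hf1, fun y hy => ?_⟩
  have hpi := Real.pi_gt_three
  have hcos : 0 < Real.cos δ := Real.cos_pos_of_mem_Ioo ⟨by linarith, by linarith⟩
  have h1 := hf _ _ (Real.sin_nonneg_of_nonneg_of_le_pi hδ0.le (by linarith)) y hy
  have h2 : Real.sin δ * |f y| / r ≤ δ * |f y| / r := by
    gcongr
    exact Real.sin_le hδ0.le
  have h3 := Real.add_one_le_exp (δ * |f y| / r)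
  have h4 := one_lt_exp_sq_mul_cos hδ0 hδ1
  rw [Real.exp_add]
  refine lt_of_mul_lt_mul_left ?_ hcos.le
  calc Real.cos δ * gauge K x ≤ Real.exp (δ * |f y| / r) := by linarith
    _ < Real.exp (δ * |f y| / r) * (Real.exp (δ ^ 2) * Real.cos δ) :=
      lt_mul_of_one_lt_right (Real.exp_pos _) h4
    _ = _ := by ring

omit [FiniteDimensional ℝ E] [MeasurableSpace E] [BorelSpace E] in
lemma subset_exp_smul {K : Set E} (hc : Convex ℝ K) (h0 : (0 : E) ∈ K) {s : ℝ} (hs : 0 ≤ s) :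
    K ⊆ Real.exp s • K :=
  fun _ hx => hc.mem_smul_of_zero_mem h0 hx (Real.one_le_exp hs)

/-- The probability of entering `K` in one rotation step is at most the Gaussian measure of a
randomly dilated copy of `K`, outside `K`. -/
lemma measure_crossing_le_lintegral {K : Set E} (hc : Convex ℝ K) (ho : IsOpen K)
    (hs : ∀ x ∈ K, -x ∈ K) {r : ℝ} (hr : 0 < r) (hb : Metric.closedBall (0 : E) r ⊆ K)
    {δ : ℝ} (hδ0 : 0 < δ) (hδ1 : δ < 1) :
    ((ProbabilityTheory.stdGaussian E).prod (ProbabilityTheory.stdGaussian E))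
        {p | p.1 ∉ K ∧ Real.cos δ • p.1 + Real.sin δ • p.2 ∈ K} ≤
      ∫⁻ g, (ProbabilityTheory.stdGaussian E)
        ((Real.exp (δ * |g| / r + δ ^ 2) • K) \ K) ∂(gaussianReal 0 1) := by
  set γ := ProbabilityTheory.stdGaussian E
  have h0 : (0 : E) ∈ K := hb (Metric.mem_closedBall_self hr.le)
  have habs : Absorbent ℝ K := absorbent_nhds_zero (ho.mem_nhds h0)
  have hK : MeasurableSet K := ho.measurableSet
  have hm : MeasurableSet {p : E × E | p.1 ∉ K ∧ Real.cos δ • p.1 + Real.sin δ • p.2 ∈ K} :=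
    (measurable_fst hK.compl).inter
      ((by fun_prop : Measurable fun p : E × E => Real.cos δ • p.1 + Real.sin δ • p.2) hK)
  have hg : Measurable (gauge K) := (continuous_gauge hc (ho.mem_nhds h0)).measurable
  let B : Set (E × ℝ) := {p | p.1 ∉ K ∧ gauge K p.1 < Real.exp (δ * |p.2| / r + δ ^ 2)}
  have hB : MeasurableSet B :=
    (measurable_fst hK.compl).inter
      (measurableSet_lt (hg.comp measurable_fst)
        (Continuous.measurable (by fun_prop)))
  calc _ = ∫⁻ x, γ {y | x ∉ K ∧ Real.cos δ • x + Real.sin δ • y ∈ K} ∂γ :=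
        Measure.prod_apply hm
    _ ≤ ∫⁻ x, gaussianReal 0 1 (Prod.mk x ⁻¹' B) ∂γ := by
        refine lintegral_mono fun x => ?_
        by_cases hx : x ∈ K
        · simp [hx]
        · obtain ⟨f, hf1, hf⟩ := exists_norm_one_gauge_lt_exp hc ho hs hr hb hδ0 hδ1 hx
          rw [← map_stdGaussian_of_norm_eq_one hf1,
            Measure.map_apply (by fun_prop) (measurable_prodMk_left hB)]
          exact measure_mono fun y hy => ⟨hx, hf y hy.2⟩
    _ = (γ.prod (gaussianReal 0 1)) B := (Measure.prod_apply hB).symm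
    _ = ∫⁻ g, γ ((fun x => (x, g)) ⁻¹' B) ∂(gaussianReal 0 1) := Measure.prod_apply_symm hB
    _ ≤ _ := by
        refine lintegral_mono fun g => measure_mono fun x hx => ⟨?_, hx.1⟩
        obtain ⟨t, ht0, ht1, ht⟩ := exists_lt_of_gauge_lt habs hx.2
        have h1 := (hc.smul t).mem_smul_of_zero_mem ⟨0, h0, smul_zero t⟩ ht
          ((one_le_div ht0).2 ht1.le)
        rwa [smul_smul, div_mul_cancel₀ _ ht0.ne'] at h1

lemma integral_sq_gaussianReal_zero_one : ∫ g, g ^ 2 ∂(gaussianReal 0 1) = 1 := by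
  have h := variance_fun_id_gaussianReal (μ := 0) (v := 1)
  rw [variance_of_integral_eq_zero (by fun_prop) (by simp)] at h
  simpa using h

/-- The derivative at `t = 1` of the Gaussian measure of `t • K` is bounded below in terms of the
inradius and the measure of the symmetric convex set `K`. -/
lemma measureReal_mul_compl_le_setIntegral {K : Set E} (hc : Convex ℝ K) (ho : IsOpen K)
    (hs : ∀ x ∈ K, -x ∈ K) {r : ℝ} (hr : 0 < r) (hb : Metric.closedBall (0 : E) r ⊆ K) :
    (ProbabilityTheory.stdGaussian E).real Kᶜ * (ProbabilityTheory.stdGaussian E).real K ≤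
      Real.pi / 2 * ((∫ x in K, ((Module.finrank ℝ E : ℝ) - ‖x‖ ^ 2)
        ∂(ProbabilityTheory.stdGaussian E)) / r) := by
  set γ := ProbabilityTheory.stdGaussian E
  set D : ℝ := ∫ x in K, ((Module.finrank ℝ E : ℝ) - ‖x‖ ^ 2) ∂γ
  have h0 : (0 : E) ∈ K := hb (Metric.mem_closedBall_self hr.le)
  have hK : MeasurableSet K := ho.measurableSet
  obtain ⟨C, hC, hF⟩ := exists_measureReal_exp_smul_sub_le hK
  change ∀ s : ℝ, 0 ≤ s → γ.real (Real.exp s • K) - γ.real K ≤ s * D + C * s ^ 2 at hF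
  have hD : 0 ≤ D := by
    by_contra! hneg
    have hs0 : 0 < -D / (2 * C + 1) := by apply div_pos <;> linarith
    have h1 := hF _ hs0.le
    have h2 : γ.real K ≤ γ.real (Real.exp (-D / (2 * C + 1)) • K) :=
      measureReal_mono (subset_exp_smul hc h0 hs0.le) (measure_ne_top _ _)
    have h3 : 0 ≤ (-D / (2 * C + 1)) * (D + C * (-D / (2 * C + 1))) := by nlinarith
    have h4 : 0 ≤ D + C * (-D / (2 * C + 1)) := nonneg_of_mul_nonneg_right h3 hs0
    have h5 : C * (-D / (2 * C + 1)) ≤ -D / 2 := by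
      rw [mul_div_assoc', div_le_div_iff₀ (by linarith) two_pos]
      nlinarith
    linarith
  have hint : Integrable (fun g : ℝ => g ^ 2) (gaussianReal 0 1) :=
    (memLp_id_gaussianReal 2).integrable_sq
  have key : ∀ δ : ℝ, 0 < δ → δ < 1 →
      (γ.prod γ).real {p | p.1 ∉ K ∧ Real.cos δ • p.1 + Real.sin δ • p.2 ∈ K} ≤
        δ * (D / r + δ * (D + 2 * C / r ^ 2 + 2 * C * δ ^ 2)) := by
    intro δ hδ0 hδ1
    have hpt : ∀ g : ℝ, γ ((Real.exp (δ * |g| / r + δ ^ 2) • K) \ K) ≤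
        ENNReal.ofReal ((δ * D / (2 * r) + δ ^ 2 * D + 2 * C * δ ^ 4) +
          (δ * D / (2 * r) + 2 * C * δ ^ 2 / r ^ 2) * g ^ 2) := by
      intro g
      have hσ : 0 ≤ δ * |g| / r + δ ^ 2 := by positivity
      rw [← ofReal_measureReal, measureReal_sdiff (subset_exp_smul hc h0 hσ) hK]
      refine ENNReal.ofReal_le_ofReal ((hF _ hσ).trans ?_)
      have h1 : δ * |g| / r ≤ δ / (2 * r) + δ / (2 * r) * g ^ 2 := by
        have : |g| ≤ (1 + g ^ 2) / 2 := by nlinarith [sq_nonneg (|g| - 1), sq_abs g]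
        calc δ * |g| / r ≤ δ * ((1 + g ^ 2) / 2) / r := by gcongr
          _ = _ := by field_simp
      have h2 : (δ * |g| / r + δ ^ 2) ^ 2 ≤ 2 * δ ^ 2 / r ^ 2 * g ^ 2 + 2 * δ ^ 4 := by
        have : (δ * |g| / r) ^ 2 = δ ^ 2 / r ^ 2 * g ^ 2 := by
          rw [div_pow, mul_pow, sq_abs]; ring
        rw [show 2 * δ ^ 2 / r ^ 2 * g ^ 2 = 2 * (δ * |g| / r) ^ 2 by rw [this]; ring]
        nlinarith [sq_nonneg (δ * |g| / r - δ ^ 2)]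
      calc (δ * |g| / r + δ ^ 2) * D + C * (δ * |g| / r + δ ^ 2) ^ 2
          ≤ (δ / (2 * r) + δ / (2 * r) * g ^ 2 + δ ^ 2) * D +
            C * (2 * δ ^ 2 / r ^ 2 * g ^ 2 + 2 * δ ^ 4) := by gcongr
        _ = _ := by ring
    have h1 := (measure_crossing_le_lintegral hc ho hs hr hb hδ0 hδ1).trans (lintegral_mono hpt)
    have hi : Integrable (fun g : ℝ => (δ * D / (2 * r) + δ ^ 2 * D + 2 * C * δ ^ 4) +
        (δ * D / (2 * r) + 2 * C * δ ^ 2 / r ^ 2) * g ^ 2) (gaussianReal 0 1) :=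
      (integrable_const _).add (hint.const_mul _)
    rw [← ofReal_integral_eq_lintegral_ofReal hi (ae_of_all _ fun g => by positivity),
      integral_add (integrable_const _) (hint.const_mul _), integral_const_mul,
      integral_sq_gaussianReal_zero_one] at h1
    refine (ENNReal.toReal_le_of_le_ofReal ?_ h1).trans (le_of_eq ?_)
    · simp only [integral_const, probReal_univ, one_smul]
      positivity
    · simp only [integral_const, probReal_univ, one_smul]
      field_simp
      ring
  have hlim : Filter.Tendsto (fun N : ℕ => Real.pi / (2 * (N : ℝ))) Filter.atTop (nhds 0) :=
    Filter.Tendsto.const_div_atTop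
      (tendsto_natCast_atTop_atTop.const_mul_atTop two_pos) _
  have hlim2 : Filter.Tendsto (fun N : ℕ => Real.pi / 2 * (D / r + Real.pi / (2 * (N : ℝ)) *
      (D + 2 * C / r ^ 2 + 2 * C * (Real.pi / (2 * (N : ℝ))) ^ 2))) Filter.atTop
      (nhds (Real.pi / 2 * (D / r))) := by
    have := ((hlim.mul (((hlim.pow 2).const_mul (2 * C)).const_add
      (D + 2 * C / r ^ 2))).const_add (D / r)).const_mul (Real.pi / 2)
    simpa using this
  refine ge_of_tendsto hlim2 ?_
  filter_upwards [hlim.eventually (gt_mem_nhds one_pos), Filter.eventually_gt_atTop 0]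
    with N hN1 hN0
  have hN : (0 : ℝ) < N := Nat.cast_pos.2 hN0
  have hδ0 : 0 < Real.pi / (2 * (N : ℝ)) := by positivity
  refine (measureReal_mul_compl_le_crossing hK hN0).trans ?_
  refine (mul_le_mul_of_nonneg_left (key _ hδ0 hN1) hN.le).trans (le_of_eq ?_)
  rw [← mul_assoc]
  congr 1
  field_simp

end StandardGaussian

section HermiteWeight

variable {n : ℕ}

lemma stdGaussian_eq_stdGaussian_euclideanSpace (n : ℕ) :
    _root_.stdGaussian n = ProbabilityTheory.stdGaussian (EuclideanSpace ℝ (Fin n)) := by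
  rw [← map_pi_eq_stdGaussian]
  rfl

lemma normHermite_zero (x : ℝ) : normHermite 0 x = 1 := by
  simp [normHermite]

lemma normHermite_two (x : ℝ) : normHermite 2 x = (x ^ 2 - 1) / √2 := by
  simp [normHermite, Polynomial.hermite_succ, Nat.factorial]
  ring

lemma prod_normHermite_single_two (i : Fin n) (x : EuclideanSpace ℝ (Fin n)) :
    ∏ j, normHermite (Pi.single (M := fun _ => ℕ) i 2 j) (x j) = (x i ^ 2 - 1) / √2 := by
  rw [Finset.prod_eq_single i]
  · rw [Pi.single_eq_same, normHermite_two]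
  · intro j _ hj
    rw [Pi.single_eq_of_ne hj, normHermite_zero]
  · simp

lemma integral_coord_sq_stdGaussian (i : Fin n) :
    ∫ x, x i ^ 2 ∂(ProbabilityTheory.stdGaussian (EuclideanSpace ℝ (Fin n))) = 1 := by
  rw [← map_pi_eq_stdGaussian, integral_map (by fun_prop)
    (Continuous.aestronglyMeasurable (by fun_prop))]
  exact (integral_comp_eval (μ := fun _ : Fin n => gaussianReal 0 1) (i := i)
    (f := fun g : ℝ => g ^ 2) (Continuous.aestronglyMeasurable (by fun_prop))).trans
    integral_sq_gaussianReal_zero_one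

lemma integrable_coord_sq_stdGaussian (i : Fin n) :
    Integrable (fun x => x i ^ 2)
      (ProbabilityTheory.stdGaussian (EuclideanSpace ℝ (Fin n))) :=
  Integrable.of_integral_ne_zero (by rw [integral_coord_sq_stdGaussian]; exact one_ne_zero)

lemma integral_finrank_sub_norm_sq_stdGaussian :
    ∫ x, ((n : ℝ) - ‖x‖ ^ 2)
      ∂(ProbabilityTheory.stdGaussian (EuclideanSpace ℝ (Fin n))) = 0 := by
  simp_rw [EuclideanSpace.norm_sq_eq, Real.norm_eq_abs, sq_abs]
  rw [integral_sub (integrable_const _)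
    (integrable_finsetSum _ fun i _ => integrable_coord_sq_stdGaussian i),
    integral_finsetSum _ fun i _ => integrable_coord_sq_stdGaussian i]
  simp [integral_coord_sq_stdGaussian]

lemma integral_pmInd_mul {K : Set (EuclideanSpace ℝ (Fin n))} (hc : Convex ℝ K)
    {g : EuclideanSpace ℝ (Fin n) → ℝ}
    (hg : Integrable g (ProbabilityTheory.stdGaussian (EuclideanSpace ℝ (Fin n)))) :
    Integrable (fun x => pmInd K x * g x)
      (ProbabilityTheory.stdGaussian (EuclideanSpace ℝ (Fin n))) ∧
    ∫ x, pmInd K x * g x ∂(ProbabilityTheory.stdGaussian (EuclideanSpace ℝ (Fin n))) =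
      2 * ∫ x in interior K, g x ∂(ProbabilityTheory.stdGaussian (EuclideanSpace ℝ (Fin n))) -
        ∫ x, g x ∂(ProbabilityTheory.stdGaussian (EuclideanSpace ℝ (Fin n))) := by
  set γ := ProbabilityTheory.stdGaussian (EuclideanSpace ℝ (Fin n))
  have hfr : γ (frontier K) = 0 :=
    stdGaussian_absolutelyContinuous (hc.addHaar_frontier volume)
  have hm : MeasurableSet (interior K) := isOpen_interior.measurableSet
  have hae : (fun x => 2 * (interior K).indicator g x - g x) =ᵐ[γ] fun x => pmInd K x * g x := by
    filter_upwards [measure_eq_zero_iff_ae_notMem.1 hfr] with x hx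
    by_cases h : x ∈ interior K
    · rw [Set.indicator_of_mem h, pmInd, if_pos (interior_subset h)]
      ring
    · have hxK : x ∉ K := fun hK => hx ⟨subset_closure hK, h⟩
      rw [Set.indicator_of_notMem h, pmInd, if_neg hxK]
      ring
  have hi : Integrable (fun x => 2 * (interior K).indicator g x) γ :=
    (hg.indicator hm).const_mul 2
  refine ⟨(hi.sub hg).congr hae, ?_⟩
  rw [← integral_congr_ae hae, integral_sub hi hg, integral_const_mul, integral_indicator hm]

lemma summable_hermiteWeight (f : EuclideanSpace ℝ (Fin n) → ℝ) (j : ℕ) :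
    Summable fun S : {S : Fin n → ℕ // ∑ i, S i = j} => (hermiteCoeff n f S.1) ^ 2 := by
  have : Finite {S : Fin n → ℕ // ∑ i, S i = j} :=
    ((Set.finite_Iic fun _ : Fin n => j).subset fun S (hS : ∑ i, S i = j) i =>
      hS ▸ Finset.single_le_sum (fun _ _ => Nat.zero_le _) (Finset.mem_univ i)).to_subtype
  exact Summable.of_finite

lemma sq_hermiteCoeff_zero_le (f : EuclideanSpace ℝ (Fin n) → ℝ) :
    (hermiteCoeff n f 0) ^ 2 ≤ hermiteWeight n f 0 :=
  (summable_hermiteWeight f 0).le_tsum ⟨0, by simp⟩ fun _ _ => sq_nonneg _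

lemma sum_sq_hermiteCoeff_single_two_le (f : EuclideanSpace ℝ (Fin n) → ℝ) :
    ∑ i, (hermiteCoeff n f (Pi.single i 2)) ^ 2 ≤ hermiteWeight n f 2 := by
  let e : Fin n → {S : Fin n → ℕ // ∑ i, S i = 2} := fun i =>
    ⟨Pi.single i 2, by simp⟩
  have he : Function.Injective e := fun i j h => by
    have h1 := congrFun (congrArg Subtype.val h) i
    by_contra hij
    simp [e, Pi.single_eq_of_ne hij] at h1
  have := tsum_comp_le_tsum_of_inj (summable_hermiteWeight f 2) (fun _ => sq_nonneg _) he
  rwa [tsum_fintype] at this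

lemma hermiteCoeff_pmInd_zero {K : Set (EuclideanSpace ℝ (Fin n))} (hc : Convex ℝ K) :
    hermiteCoeff n (pmInd K) 0 =
      2 * (ProbabilityTheory.stdGaussian (EuclideanSpace ℝ (Fin n))).real (interior K) - 1 := by
  rw [hermiteCoeff, stdGaussian_eq_stdGaussian_euclideanSpace]
  have := (integral_pmInd_mul hc (integrable_const (1 : ℝ))).2
  simpa [normHermite_zero] using this

/-- The sum of the degree-two coefficients along the axes is a dilation derivative. -/
lemma sum_hermiteCoeff_pmInd_single_two {K : Set (EuclideanSpace ℝ (Fin n))}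
    (hc : Convex ℝ K) :
    ∑ i, hermiteCoeff n (pmInd K) (Pi.single i 2) =
      -√2 * ∫ x in interior K, ((n : ℝ) - ‖x‖ ^ 2)
        ∂(ProbabilityTheory.stdGaussian (EuclideanSpace ℝ (Fin n))) := by
  have hi : ∀ i : Fin n, Integrable (fun x => (x i ^ 2 - 1) / √2)
      (ProbabilityTheory.stdGaussian (EuclideanSpace ℝ (Fin n))) := fun i =>
    ((integrable_coord_sq_stdGaussian i).sub (integrable_const _)).div_const _
  have hsum : ∀ x : EuclideanSpace ℝ (Fin n),
      ∑ i, pmInd K x * ((x i ^ 2 - 1) / √2) =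
        -(√2)⁻¹ * (pmInd K x * ((n : ℝ) - ‖x‖ ^ 2)) := fun x => by
    rw [← Finset.mul_sum, ← Finset.sum_div, Finset.sum_sub_distrib, EuclideanSpace.norm_sq_eq]
    simp only [Real.norm_eq_abs, sq_abs, Finset.sum_const, Finset.card_univ, Fintype.card_fin,
      nsmul_eq_mul, mul_one]
    ring
  have hint : Integrable (fun x => (n : ℝ) - ‖x‖ ^ 2)
      (ProbabilityTheory.stdGaussian (EuclideanSpace ℝ (Fin n))) := by
    simpa using integrable_finrank_sub_norm_sq_stdGaussian (E := EuclideanSpace ℝ (Fin n))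
  simp_rw [hermiteCoeff, stdGaussian_eq_stdGaussian_euclideanSpace, prod_normHermite_single_two]
  rw [← integral_finsetSum _ fun i _ => (integral_pmInd_mul hc (hi i)).1]
  simp_rw [hsum]
  rw [integral_const_mul, (integral_pmInd_mul hc hint).2,
    integral_finrank_sub_norm_sq_stdGaussian]
  have h2 : √2 * √2 = (2 : ℝ) := Real.mul_self_sqrt (by norm_num)
  have h3 : (√2)⁻¹ * 2 = √2 := by rw [inv_mul_eq_div, div_eq_iff (by positivity), h2]
  rw [sub_zero, ← mul_assoc, neg_mul, h3]

lemma sq_setIntegral_le_hermiteWeight_two {K : Set (EuclideanSpace ℝ (Fin n))}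
    (hc : Convex ℝ K) :
    2 * (∫ x in interior K, ((n : ℝ) - ‖x‖ ^ 2)
        ∂(ProbabilityTheory.stdGaussian (EuclideanSpace ℝ (Fin n)))) ^ 2 ≤
      n * hermiteWeight n (pmInd K) 2 := by
  have h := sq_sum_le_card_mul_sum_sq (s := Finset.univ)
    (f := fun i : Fin n => hermiteCoeff n (pmInd K) (Pi.single i 2))
  rw [sum_hermiteCoeff_pmInd_single_two hc, mul_pow, neg_sq, Real.sq_sqrt (by norm_num),
    Finset.card_univ, Fintype.card_fin] at h
  exact h.trans (mul_le_mul_of_nonneg_left (sum_sq_hermiteCoeff_single_two_le _)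
    (Nat.cast_nonneg _))

lemma hermiteWeight_nonneg (f : EuclideanSpace ℝ (Fin n) → ℝ) (j : ℕ) :
    0 ≤ hermiteWeight n f j :=
  tsum_nonneg fun _ => sq_nonneg _

/-- Poincaré-type inequality: the dilation derivative of a symmetric convex set of intermediate
Gaussian measure is bounded below by an absolute constant. -/
lemma one_div_fifty_le_setIntegral {K : Set (EuclideanSpace ℝ (Fin n))} (hc : Convex ℝ K)
    (hs : ∀ x, x ∈ K ↔ -x ∈ K)
    (h1 : 1 / 4 < (ProbabilityTheory.stdGaussian (EuclideanSpace ℝ (Fin n))).real (interior K))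
    (h2 : (ProbabilityTheory.stdGaussian (EuclideanSpace ℝ (Fin n))).real (interior K) < 3 / 4) :
    1 / 50 ≤ ∫ x in interior K, ((n : ℝ) - ‖x‖ ^ 2)
        ∂(ProbabilityTheory.stdGaussian (EuclideanSpace ℝ (Fin n))) := by
  have hcL : Convex ℝ (interior K) := hc.interior
  have hsL : ∀ x ∈ interior K, -x ∈ interior K := fun x hx =>
    interior_maximal (s := K) (t := -interior K)
      (fun y hy => (hs y).2 (interior_subset hy)) isOpen_interior.neg (by simpa using hx)
  have hne : (interior K).Nonempty := by
    by_contra hempty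
    rw [Set.not_nonempty_iff_eq_empty] at hempty
    rw [hempty, measureReal_empty] at h1
    norm_num at h1
  obtain ⟨x, hx⟩ := hne
  have h0 : (0 : EuclideanSpace ℝ (Fin n)) ∈ interior K := by
    have := hcL hx (hsL x hx) (a := 1 / 2) (b := 1 / 2) (by norm_num) (by norm_num) (by norm_num)
    simpa using this
  have hb := closedBall_subset_of_lt_measureReal hcL isOpen_interior hsL h0 h1
  have h := measureReal_mul_compl_le_setIntegral hcL isOpen_interior hsL (by norm_num) hb
  rw [probReal_compl_eq_one_sub isOpen_interior.measurableSet, finrank_euclideanSpace_fin] at h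
  set m := (ProbabilityTheory.stdGaussian (EuclideanSpace ℝ (Fin n))).real (interior K)
  have h3 : 3 / 16 ≤ (1 - m) * m := by nlinarith
  by_contra! hlt
  nlinarith [Real.pi_lt_four, Real.pi_pos]

end HermiteWeight

/-- Every centrally symmetric convex set has Hermite weight at least `c/n` at
levels 0 and 2 combined. -/
theorem hermite_weight_symmetric_convex :
    ∃ c : ℝ, 0 < c ∧ ∃ n₀ : ℕ, ∀ n : ℕ, n₀ ≤ n →
      ∀ K : Set (EuclideanSpace ℝ (Fin n)),
        Convex ℝ K → (∀ x, x ∈ K ↔ -x ∈ K) →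
        c / n ≤ hermiteWeight n (pmInd K) 0 + hermiteWeight n (pmInd K) 2 := by
  refine ⟨1 / 1250, by norm_num, 1, fun n hn K hc hs => ?_⟩
  have hn' : (1 : ℝ) ≤ n := Nat.one_le_cast.2 hn
  have h0 := sq_hermiteCoeff_zero_le (pmInd K)
  rw [hermiteCoeff_pmInd_zero hc] at h0
  have h2 := sq_setIntegral_le_hermiteWeight_two hc
  have hw0 := hermiteWeight_nonneg (pmInd K) 0
  have hw2 := hermiteWeight_nonneg (pmInd K) 2
  rw [div_le_iff₀ (by linarith)]
  by_cases hmid : 1 / 4 < (ProbabilityTheory.stdGaussian (EuclideanSpace ℝ (Fin n))).real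
      (interior K) ∧ (ProbabilityTheory.stdGaussian (EuclideanSpace ℝ (Fin n))).real
      (interior K) < 3 / 4
  · have h := one_div_fifty_le_setIntegral hc hs hmid.1 hmid.2
    nlinarith
  · have hq : 1 / 4 ≤ hermiteWeight n (pmInd K) 0 := by
      refine le_trans ?_ h0
      rw [not_and_or, not_lt, not_lt] at hmid
      rcases hmid with h | h <;> nlinarith
    nlinarith
end
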